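/- Fix an integer r ≥ 2 and an r-critical graph F. For integers n ≥ m ≥ 1 define E[X_m] = C(n,m)·f_F(m)·2^{−C(m,2)}, where f_F(m) is the number of F-free graphs on vertex set {1,…,m} (this equals the expected number of m-element vertex subsets of G_{n,1/2} whose induced subgraph is F-free), and define m₀(n) = min{m : E[X_m] ≤ 1}. Then there exist C > 0 and N such that for all n ≥ N, |m₀(n) − 2r·log₂ n| ≤ C·log log n. -/

import Mathlib

open scoped Classical

/-- `G` contains a (not necessarily induced) copy of `F` as a subgraph. -/
def HasCopy {V : Type*} {W : Type*} (F : SimpleGraph V) (G : SimpleGraph W) : Prop :=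
  ∃ f : V ↪ W, ∀ a b, F.Adj a b → G.Adj (f a) (f b)

/-- `F` is `r`-critical: `χ(F) = r + 1` and some edge's deletion reduces the
chromatic number to `r`. -/
def IsCritical {V : Type*} (r : ℕ) (F : SimpleGraph V) : Prop :=
  F.chromaticNumber = (r + 1 : ℕ) ∧
    ∃ e ∈ F.edgeSet, (F.deleteEdges {e}).chromaticNumber = (r : ℕ)

/-- `f_F(m)`: the number of `F`-free graphs on vertex set `{1,…,m}`. -/
noncomputable def numFFree {V : Type*} (F : SimpleGraph V) (m : ℕ) : ℕ :=
  Nat.card {G : SimpleGraph (Fin m) // ¬ HasCopy F G}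

/-- `E[X_m] = C(n,m)·f_F(m)·2^{-C(m,2)}`, the expected number of `m`-element vertex
subsets of `G_{n,1/2}` whose induced subgraph is `F`-free. -/
noncomputable def expXF {V : Type*} (F : SimpleGraph V) (n m : ℕ) : ℝ :=
  (n.choose m : ℝ) * (numFFree F m : ℝ) / 2 ^ (m.choose 2)

/-- `m₀(n) = min{m ≥ 1 : E[X_m] ≤ 1}`. -/
noncomputable def mZero {V : Type*} (F : SimpleGraph V) (n : ℕ) : ℕ :=
  sInf {m : ℕ | 1 ≤ m ∧ expXF F n m ≤ 1}

section

open Finset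
open Filter (atTop eventually_atTop eventually_ge_atTop)

/-- The proportion of graphs on `V` that satisfy `Q`. -/
noncomputable def gdens {V : Type*} [Fintype V] (Q : SimpleGraph V → Prop) : ℝ :=
  (Set.ncard {G | Q G} : ℝ) / 2 ^ (Fintype.card V).choose 2

theorem gdens_nonneg {V : Type*} [Fintype V] (Q : SimpleGraph V → Prop) : 0 ≤ gdens Q := by
  unfold gdens; positivity

theorem gdens_mono {V : Type*} [Fintype V] {Q R : SimpleGraph V → Prop} (h : ∀ G, Q G → R G) :
    gdens Q ≤ gdens R := by
  unfold gdens
  have : Set.ncard {G | Q G} ≤ Set.ncard {G | R G} :=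
    Set.ncard_le_ncard (fun G hG => h G hG) (Set.toFinite _)
  exact div_le_div_of_nonneg_right (by exact_mod_cast this) (by positivity)

theorem gdens_or_le {V : Type*} [Fintype V] (Q R : SimpleGraph V → Prop) :
    gdens (fun G => Q G ∨ R G) ≤ gdens Q + gdens R := by
  unfold gdens
  rw [← add_div]
  gcongr
  exact_mod_cast Set.ncard_union_le {G | Q G} {G | R G}

theorem gdens_exists_mem_le {V α : Type*} [Fintype V] (s : Finset α) (Q : α → SimpleGraph V → Prop)
    {c : ℝ} (h : ∀ a ∈ s, gdens (Q a) ≤ c) : gdens (fun G => ∃ a ∈ s, Q a G) ≤ #s * c := by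
  induction s using Finset.induction_on with
  | empty => simp [gdens]
  | insert a s ha ih =>
    rw [card_insert_of_notMem ha]
    have h1 := ih fun b hb => h b (mem_insert_of_mem hb)
    have h2 := h a (mem_insert_self a s)
    have h3 := gdens_or_le (Q a) (fun G => ∃ a ∈ s, Q a G)
    have h4 : gdens (fun G => ∃ b ∈ insert a s, Q b G) ≤
        gdens (fun G => Q a G ∨ ∃ a ∈ s, Q a G) := gdens_mono (by simp)
    push_cast
    linarith

theorem gdens_exists_le {V α : Type*} [Fintype V] [Fintype α] (Q : α → SimpleGraph V → Prop)
    {c : ℝ} (h : ∀ a, gdens (Q a) ≤ c) : gdens (fun G => ∃ a, Q a G) ≤ Fintype.card α * c := by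
  simpa using gdens_exists_mem_le univ Q fun a _ => h a

theorem gdens_comap_equiv {V W : Type*} [Fintype V] [Fintype W] (e : V ≃ W)
    (Q : SimpleGraph V → Prop) (R : SimpleGraph W → Prop)
    (h : ∀ G : SimpleGraph W, R G → Q (G.comap e)) : gdens R ≤ gdens Q := by
  unfold gdens
  rw [Fintype.card_congr e]
  gcongr
  refine Set.ncard_le_ncard_of_injOn (fun G => G.comap e) (fun G hG => h G hG) ?_ (Set.toFinite _)
  intro G _ G' _ hGG
  ext a b
  have := congrArg (fun H : SimpleGraph V => H.Adj (e.symm a) (e.symm b)) hGG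
  simpa using this

/-- Events depending on pairwise disjoint blocks of edges have densities that multiply. -/
theorem gdens_le_prod_blocks {V ι α β : Type*} [Fintype V] [Fintype ι] (Q : SimpleGraph V → Prop)
    (b₀ : Finset (Sym2 V)) (b : ι → Finset (Sym2 V))
    (hb₀ : ∀ e ∈ b₀, ¬ e.IsDiag) (hb : ∀ i, ∀ e ∈ b i, ¬ e.IsDiag)
    (hd₀ : ∀ i, Disjoint b₀ (b i)) (hd : ∀ i j, i ≠ j → Disjoint (b i) (b j))
    (σ₀ : SimpleGraph V → β) (S₀ : Finset β) (σ : ι → SimpleGraph V → α) (S : ι → Finset α)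
    (h₀ : ∀ G, Q G → σ₀ G ∈ S₀) (h : ∀ G, Q G → ∀ i, σ i G ∈ S i)
    (e₀ : ∀ G G', Q G → Q G' → σ₀ G = σ₀ G' → ∀ e ∈ b₀, e ∈ G.edgeSet → e ∈ G'.edgeSet)
    (e₁ : ∀ G G', Q G → Q G' → ∀ i, σ i G = σ i G' → ∀ e ∈ b i, e ∈ G.edgeSet → e ∈ G'.edgeSet) :
    gdens Q ≤ #S₀ / 2 ^ #b₀ * ∏ i, ((#(S i) : ℝ) / 2 ^ #(b i)) := by
  set E : Finset (Sym2 V) := univ.filter fun e => ¬ e.IsDiag with hE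
  have hEc : #E = (Fintype.card V).choose 2 := by
    rw [← Sym2.card_subtype_not_diag, Fintype.card_subtype]
  set B := b₀ ∪ univ.biUnion b with hB
  have hBE : B ⊆ E := by
    intro e he
    simp only [hB, mem_union, mem_biUnion, mem_univ, true_and] at he
    simp only [hE, mem_filter, mem_univ, true_and]
    rcases he with he | ⟨i, he⟩
    exacts [hb₀ e he, hb i e he]
  have hBc : #B = #b₀ + ∑ i, #(b i) := by
    rw [hB, card_union_of_disjoint, card_biUnion]
    · exact fun i _ j _ hij => hd i j hij
    · rw [disjoint_biUnion_right]; exact fun i _ => hd₀ i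
  set P := (E \ B).powerset ×ˢ (S₀ ×ˢ Fintype.piFinset S) with hP
  have key : Set.ncard {G | Q G} ≤ #P := by
    rw [← Set.ncard_coe_finset P]
    refine Set.ncard_le_ncard_of_injOn
      (fun G => (univ.filter fun e => e ∈ G.edgeSet ∧ e ∉ B, σ₀ G, fun i => σ i G)) ?_ ?_
      (Set.toFinite _)
    · intro G hG
      simp only [hP, mem_coe, mem_product, mem_powerset, Fintype.mem_piFinset]
      refine ⟨?_, h₀ G hG, h G hG⟩
      intro e he
      simp only [mem_filter, mem_univ, true_and] at he
      simp only [mem_sdiff, hE, mem_filter, mem_univ, true_and]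
      exact ⟨G.not_isDiag_of_mem_edgeSet he.1, he.2⟩
    · have main : ∀ G G', Q G → Q G' →
          (univ.filter fun e => e ∈ G.edgeSet ∧ e ∉ B) =
            (univ.filter fun e => e ∈ G'.edgeSet ∧ e ∉ B) →
          σ₀ G = σ₀ G' → (∀ i, σ i G = σ i G') → ∀ e, e ∈ G.edgeSet → e ∈ G'.edgeSet := by
        intro G G' hG hG' h1 h2 h3 e he
        by_cases heB : e ∈ B
        · simp only [hB, mem_union, mem_biUnion, mem_univ, true_and] at heB
          rcases heB with heB | ⟨i, heB⟩
          exacts [e₀ G G' hG hG' h2 e heB he, e₁ G G' hG hG' i (h3 i) e heB he]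
        · have : e ∈ univ.filter fun e => e ∈ G'.edgeSet ∧ e ∉ B := by
            rw [← h1]; simp [he, heB]
          simp only [mem_filter, mem_univ, true_and] at this
          exact this.1
      intro G hG G' hG' hGG
      simp only [Prod.mk.injEq] at hGG
      obtain ⟨h1, h2, h3⟩ := hGG
      rw [← SimpleGraph.edgeSet_inj]
      exact Set.Subset.antisymm (fun e => main G G' hG hG' h1 h2 (congrFun h3) e)
        (fun e => main G' G hG' hG h1.symm h2.symm (fun i => (congrFun h3 i).symm) e)
  have hPc : (#P : ℝ) = 2 ^ #(E \ B) * (#S₀ * ∏ i, (#(S i) : ℝ)) := by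
    rw [hP, card_product, card_product, card_powerset, Fintype.card_piFinset]
    push_cast; rfl
  have hs : #(E \ B) + (#b₀ + ∑ i, #(b i)) = (Fintype.card V).choose 2 := by
    rw [← hBc, ← hEc, card_sdiff_add_card_eq_card hBE]
  have h2 : (2 : ℝ) ^ (Fintype.card V).choose 2 =
      2 ^ #(E \ B) * (2 ^ #b₀ * ∏ i, (2 : ℝ) ^ #(b i)) := by
    rw [← hs, pow_add, pow_add, Finset.prod_pow_eq_pow_sum]
  unfold gdens
  rw [prod_div_distrib, div_mul_div_comm, h2]
  calc (Set.ncard {G | Q G} : ℝ) / _ ≤ #P / (2 ^ #(E \ B) * (2 ^ #b₀ * ∏ i, (2 : ℝ) ^ #(b i))) := by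
        gcongr
    _ = _ := by
        rw [hPc, mul_div_mul_left _ _ (by positivity)]

theorem gdens_le_one {V : Type*} [Fintype V] (Q : SimpleGraph V → Prop) : gdens Q ≤ 1 := by
  have := gdens_le_prod_blocks (ι := Empty) (α := Unit) Q ∅ (fun _ => ∅) (by simp) (by simp)
    (by simp) (by simp) (fun _ => ()) univ (fun _ _ => ()) (fun _ => univ) (by simp) (by simp)
    (by simp) (by simp)
  simpa using this

theorem card_filter_card_lt_le (κ : Type*) [Fintype κ] (s : ℕ) :
    #(univ.filter fun P : Finset κ => #P < s) ≤ (Fintype.card κ + 1) ^ s := by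
  have h1 : #(univ.filter fun P : Finset κ => #P < s) =
      ∑ j ∈ range s, #(univ.filter fun P : Finset κ => #P = j) := by
    rw [card_eq_sum_card_fiberwise (t := range s) (f := fun P : Finset κ => #P)]
    · refine sum_congr rfl fun j hj => congrArg _ ?_
      ext P
      simp only [mem_filter, mem_univ, true_and, and_iff_right_iff_imp]
      rintro rfl
      simpa using hj
    · intro P hP
      simpa using hP
  rw [h1, add_pow]
  calc ∑ j ∈ range s, #(univ.filter fun P : Finset κ => #P = j)
      ≤ ∑ j ∈ range s, Fintype.card κ ^ j * 1 ^ (s - j) * s.choose j := by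
        refine sum_le_sum fun j hj => ?_
        rw [← Fintype.card_subtype, Fintype.card_finset_len]
        have : 0 < s.choose j := Nat.choose_pos (by simp at hj; omega)
        calc _ ≤ Fintype.card κ ^ j := Nat.choose_le_pow _ _
          _ ≤ _ := by simpa using Nat.le_mul_of_pos_right _ this
    _ ≤ _ := sum_le_sum_of_subset (range_mono (by omega))

theorem card_filter_card_inter_lt_le {κ : Type*} [Fintype κ] [DecidableEq κ] (A : Finset κ) (s : ℕ) :
    #(univ.filter fun P : Finset κ => #(P ∩ A) < s) ≤
      (#A + 1) ^ s * 2 ^ (Fintype.card κ - #A) := by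
  have h := card_filter_card_lt_le A s
  rw [Fintype.card_coe] at h
  have h2 : #(univ : Finset (Finset (Aᶜ : Finset κ))) = 2 ^ (Fintype.card κ - #A) := by
    rw [card_univ, Fintype.card_finset, Fintype.card_coe, card_compl]
  rw [← h2]
  refine le_trans ?_ (Nat.mul_le_mul_right _ h)
  rw [← card_product]
  refine card_le_card_of_injOn (fun P => (P.subtype (· ∈ A), P.subtype (· ∈ Aᶜ))) ?_ ?_
  · intro P hP
    have hP : #(P ∩ A) < s := by simpa using hP
    simp only [coe_product, coe_filter, mem_univ, true_and, coe_univ, Set.mem_prod,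
      Set.mem_ofPred_eq, Set.mem_univ, and_true]
    rw [card_subtype, filter_mem_eq_inter]
    exact hP
  · intro P _ P' _ hPP
    simp only [Prod.mk.injEq, Finset.ext_iff, mem_subtype, Subtype.forall] at hPP
    ext x
    by_cases hx : x ∈ A
    · exact hPP.1 x hx
    · exact hPP.2 x (by simpa using hx)

/-- Few subsets of an `N`-element set are small compared with `N`. -/
theorem exists_card_small_subsets_le (ε : ℝ) (hε : 0 < ε) :
    ∃ h₀ : ℕ, ∀ h : ℕ, h₀ ≤ h → ∀ (κ : Type) [Fintype κ] (N : ℕ), Fintype.card κ ≤ N →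
      (#(univ.filter fun P : Finset κ => h * #P ≤ N) : ℝ) ≤ 2 ^ (ε * N) := by
  obtain ⟨L, hL⟩ : ∃ L : ℕ, ((1 / 2 : ℝ)) ^ L < 2 ^ (ε / 2) - 1 :=
    exists_pow_lt_of_lt_one (by
      have := Real.one_lt_rpow (x := 2) (by norm_num) (half_pos hε); linarith) (by norm_num)
  obtain ⟨h₁, hh₁⟩ := exists_nat_ge (2 * L / ε)
  refine ⟨h₁ + 1, fun h hh κ _ N hN => ?_⟩
  have hhp : (0 : ℝ) < h := by exact_mod_cast (by omega : 0 < h)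
  have hhL : (L : ℝ) * (N / h) ≤ ε / 2 * N := by
    have h3 : (h₁ : ℝ) ≤ h := by exact_mod_cast (by omega : h₁ ≤ h)
    have h4 : 2 * (L : ℝ) ≤ h * ε := by
      rw [div_le_iff₀ hε] at hh₁; nlinarith
    rw [mul_div_assoc', div_le_iff₀ hhp]
    have : (0 : ℝ) ≤ N := by positivity
    nlinarith
  have hx : (0 : ℝ) < (1 / 2) ^ L := by positivity
  calc (#(univ.filter fun P : Finset κ => h * #P ≤ N) : ℝ)
      = ∑ P ∈ univ.filter (fun P : Finset κ => h * #P ≤ N), (1 : ℝ) := by simp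
    _ ≤ ∑ P ∈ univ.filter (fun P : Finset κ => h * #P ≤ N),
          (2 : ℝ) ^ (ε / 2 * N) * ((1 / 2) ^ L) ^ #P := by
        refine sum_le_sum fun P hP => ?_
        have hP : h * #P ≤ N := by simpa using hP
        have h5 : (#P : ℝ) ≤ N / h := by
          rw [le_div_iff₀ hhp, mul_comm]; exact_mod_cast hP
        have h6 : (((1 : ℝ) / 2) ^ L) ^ #P = 2 ^ (-(L * #P : ℝ)) := by
          rw [← pow_mul, Real.rpow_neg (by norm_num), one_div, inv_pow]
          congr 1
          exact_mod_cast (Real.rpow_natCast 2 (L * #P)).symm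
        rw [h6, ← Real.rpow_add (by norm_num)]
        refine Real.one_le_rpow (by norm_num) ?_
        have : (L : ℝ) * #P ≤ L * (N / h) := by gcongr
        linarith
    _ ≤ ∑ P : Finset κ, (2 : ℝ) ^ (ε / 2 * N) * ((1 / 2) ^ L) ^ #P := by
        refine sum_le_sum_of_subset_of_nonneg (subset_univ _) fun _ _ _ => by positivity
    _ = (2 : ℝ) ^ (ε / 2 * N) * ((1 / 2) ^ L + 1) ^ Fintype.card κ := by
        rw [← mul_sum, Fintype.sum_pow_mul_eq_add_pow κ ((1 / 2 : ℝ) ^ L) 1 |>.symm]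
        simp
    _ ≤ (2 : ℝ) ^ (ε / 2 * N) * ((2 : ℝ) ^ (ε / 2)) ^ N := by
        gcongr
        calc ((1 / 2 : ℝ) ^ L + 1) ^ Fintype.card κ ≤ ((1 / 2 : ℝ) ^ L + 1) ^ N :=
              pow_le_pow_right₀ (by linarith) hN
          _ ≤ _ := by gcongr; linarith
    _ = _ := by
        rw [← Real.rpow_natCast, ← Real.rpow_mul (by norm_num), ← Real.rpow_add (by norm_num)]
        ring_nf

theorem sum_half_pow_card_inter {κ : Type*} (Z : Finset κ) :
    ∑ x ∈ Z.powerset ×ˢ Z.powerset, (1 / 2 : ℝ) ^ #(x.1 ∩ x.2) = (7 / 2) ^ #Z := by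
  rw [sum_product]
  have h1 : ∀ P ∈ Z.powerset, ∑ Q ∈ Z.powerset, (1 / 2 : ℝ) ^ #(P ∩ Q) =
      (∏ _x ∈ P, (3 / 2 : ℝ)) * ∏ _x ∈ Z \ P, (2 : ℝ) := by
    intro P hP
    have hP := mem_powerset.1 hP
    have h2 := prod_one_add (f := fun z => if z ∈ P then (1 / 2 : ℝ) else 1) Z
    have h3 : ∀ Q, ∏ z ∈ Q, (if z ∈ P then (1 / 2 : ℝ) else 1) = (1 / 2) ^ #(P ∩ Q) := by
      intro Q
      rw [prod_ite, prod_const, prod_const_one, mul_one, filter_mem_eq_inter, inter_comm]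
    simp only [h3] at h2
    rw [← h2, ← prod_sdiff hP, mul_comm]
    congr 1
    · exact prod_congr rfl fun z hz => by simp [hz]; norm_num
    · exact prod_congr rfl fun z hz => by simp [(mem_sdiff.1 hz).2]; norm_num
  rw [sum_congr rfl h1, ← prod_add, prod_const]
  norm_num

/-- Pairs of subsets of `Z` with small intersection are rare. -/
theorem card_pairs_small_inter_le {κ : Type*} (Z : Finset κ) (h n : ℕ) (hh : 0 < h) :
    (#((Z.powerset ×ˢ Z.powerset).filter fun x => h * #(x.1 ∩ x.2) < n) : ℝ) ≤
      2 ^ ((n : ℝ) / h) * (7 / 2) ^ #Z := by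
  rw [← sum_half_pow_card_inter, mul_sum]
  calc (#((Z.powerset ×ˢ Z.powerset).filter fun x => h * #(x.1 ∩ x.2) < n) : ℝ)
      = ∑ x ∈ (Z.powerset ×ˢ Z.powerset).filter (fun x => h * #(x.1 ∩ x.2) < n), (1 : ℝ) := by simp
    _ ≤ ∑ x ∈ (Z.powerset ×ˢ Z.powerset).filter (fun x => h * #(x.1 ∩ x.2) < n),
          (2 : ℝ) ^ ((n : ℝ) / h) * (1 / 2) ^ #(x.1 ∩ x.2) := by
        refine sum_le_sum fun x hx => ?_
        have hx : h * #(x.1 ∩ x.2) < n := (mem_filter.1 hx).2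
        rw [one_div, inv_pow, ← Real.rpow_natCast, ← Real.rpow_neg (by norm_num),
          ← Real.rpow_add (by norm_num)]
        refine Real.one_le_rpow (by norm_num) ?_
        have : (#(x.1 ∩ x.2) : ℝ) ≤ n / h := by
          rw [le_div_iff₀ (by exact_mod_cast hh), mul_comm]; exact_mod_cast hx.le
        linarith
    _ ≤ _ := sum_le_sum_of_subset_of_nonneg (filter_subset _ _) fun _ _ _ => by positivity

/-- `G` contains a complete `r`-partite graph with parts of size `t`. -/
def HasMultipartite {V : Type*} (r t : ℕ) (G : SimpleGraph V) : Prop :=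
  ∃ τ : Fin r × Fin t ↪ V, ∀ x y, x.1 ≠ y.1 → G.Adj (τ x) (τ y)

/-- All pairs of vertices in different members of the family `T` are adjacent. -/
def IsCompleteBetween {V ι : Type*} (G : SimpleGraph V) (T : ι → Finset V) : Prop :=
  ∀ i j, i ≠ j → ∀ a ∈ T i, ∀ b ∈ T j, G.Adj a b

/-- `G` contains a complete `r`-partite graph with parts of size at least `s`, together with
an edge inside one of the parts. -/
def HasPlus {V : Type*} (r s : ℕ) (G : SimpleGraph V) : Prop :=
  ∃ T : Fin r → Finset V, (∀ i, s ≤ #(T i)) ∧ IsCompleteBetween G T ∧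
    ∃ i, ∃ a ∈ T i, ∃ b ∈ T i, G.Adj a b

theorem HasMultipartite.of_sets {V : Type*} {r t : ℕ} {G : SimpleGraph V} (T : Fin r → Finset V)
    (hT : ∀ i, t ≤ #(T i)) (hc : IsCompleteBetween G T) : HasMultipartite r t G := by
  have he : ∀ i, Nonempty (Fin t ↪ T i) := fun i =>
    Function.Embedding.nonempty_of_card_le (by simpa using hT i)
  have he' : ∀ i, ∃ f : Fin t ↪ V, ∀ a, f a ∈ T i := fun i =>
    ⟨(he i).some.trans (Function.Embedding.subtype _), fun a => ((he i).some a).2⟩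
  choose f hf using he'
  refine ⟨⟨fun x => f x.1 x.2, ?_⟩, fun x y hxy => hc _ _ hxy _ (hf _ _) _ (hf _ _)⟩
  rintro ⟨i, a⟩ ⟨j, b⟩ hab
  have hab : f i a = f j b := hab
  by_cases hij : i = j
  · subst hij; simpa using hab
  · have := hc i j hij _ (hf i a) _ (hf j b)
    rw [hab] at this
    exact absurd this (G.loopless.irrefl _)

theorem HasMultipartite.of_comap {V W : Type*} {r t : ℕ} {G : SimpleGraph V} (f : W ↪ V)
    (h : HasMultipartite r t (G.comap f)) : HasMultipartite r t G := by
  obtain ⟨τ, hτ⟩ := h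
  exact ⟨τ.trans f, fun x y hxy => hτ x y hxy⟩

theorem HasPlus.of_comap {V W : Type*} {r s : ℕ} {G : SimpleGraph V} (f : W ↪ V)
    (h : HasPlus r s (G.comap f)) : HasPlus r s G := by
  obtain ⟨T, hT, hc, i, a, ha, b, hb, hab⟩ := h
  refine ⟨fun i => (T i).map f, by simpa using hT, ?_, i, f a, by simpa using ha, f b,
    by simpa using hb, hab⟩
  intro i j hij a ha b hb
  simp only [mem_map] at ha hb
  obtain ⟨a, ha, rfl⟩ := ha
  obtain ⟨b, hb, rfl⟩ := hb
  exact hc i j hij a ha b hb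

/-- The neighbourhood of `v` in the complete multipartite graph placed by `τ`. -/
noncomputable def nbrPattern {V : Type*} {r t : ℕ} (τ : Fin r × Fin t ↪ V) (G : SimpleGraph V)
    (v : V) : Fin r → Finset (Fin t) :=
  fun i => univ.filter fun a => G.Adj v (τ (i, a))

theorem mem_nbrPattern {V : Type*} {r t : ℕ} (τ : Fin r × Fin t ↪ V) (G : SimpleGraph V)
    (v : V) (i : Fin r) (a : Fin t) : a ∈ nbrPattern τ G v i ↔ G.Adj v (τ (i, a)) := by
  simp [nbrPattern]

/-- The proportion of neighbourhood patterns that satisfy `P`. -/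
noncomputable def patternDensity {r t : ℕ} (P : (Fin r → Finset (Fin t)) → Prop) : ℝ :=
  #(univ.filter P) / 2 ^ (r * t)

theorem patternDensity_nonneg {r t : ℕ} (P : (Fin r → Finset (Fin t)) → Prop) :
    0 ≤ patternDensity P := by unfold patternDensity; positivity

theorem patternDensity_mono {r t : ℕ} {P Q : (Fin r → Finset (Fin t)) → Prop}
    (h : ∀ p, P p → Q p) : patternDensity P ≤ patternDensity Q := by
  unfold patternDensity
  have : #(univ.filter P) ≤ #(univ.filter Q) := card_le_card (monotone_filter_right _ fun p _ => h p)
  gcongr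

theorem patternDensity_exists_le {r t : ℕ} {α : Type*} [Fintype α]
    (P : α → (Fin r → Finset (Fin t)) → Prop) {c : ℝ} (h : ∀ a, patternDensity (P a) ≤ c) :
    patternDensity (fun p => ∃ a, P a p) ≤ Fintype.card α * c := by
  calc patternDensity (fun p => ∃ a, P a p)
      ≤ ∑ a, patternDensity (P a) := by
        unfold patternDensity
        rw [← sum_div]
        gcongr
        norm_cast
        refine le_trans (card_le_card ?_) card_biUnion_le
        intro p hp
        simpa using hp
    _ ≤ ∑ _a : α, c := sum_le_sum fun a _ => h a
    _ = _ := by simp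

theorem patternDensity_pi {r t : ℕ} (A : Fin r → Finset (Finset (Fin t))) :
    patternDensity (fun p => ∀ i, p i ∈ A i) = ∏ i, ((#(A i) : ℝ) / 2 ^ t) := by
  unfold patternDensity
  rw [prod_div_distrib, prod_const, ← pow_mul, card_univ, Fintype.card_fin, mul_comm t r]
  congr 1
  norm_cast
  rw [← Fintype.card_piFinset]
  congr 1
  ext p
  simp

theorem patternDensity_one {r t : ℕ} (i : Fin r) (A : Finset (Finset (Fin t))) :
    patternDensity (fun p : Fin r → Finset (Fin t) => p i ∈ A) = #A / 2 ^ t := by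
  have h := patternDensity_pi fun j => if j = i then A else (univ : Finset (Finset (Fin t)))
  rw [prod_eq_single i (by intro j _ hj; simp [hj]) (by simp)] at h
  simp only [if_true] at h
  rw [← h]
  refine le_antisymm (patternDensity_mono ?_) (patternDensity_mono ?_)
  · intro p hp j
    by_cases hj : j = i <;> simp [hj, hp]
  · intro p hp
    simpa using hp i

theorem patternDensity_two {r t : ℕ} {i j : Fin r} (hij : i ≠ j) (A B : Finset (Finset (Fin t))) :
    patternDensity (fun p : Fin r → Finset (Fin t) => p i ∈ A ∧ p j ∈ B) =
      (#A / 2 ^ t) * (#B / 2 ^ t) := by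
  have h := patternDensity_pi fun l =>
    if l = i then A else if l = j then B else (univ : Finset (Finset (Fin t)))
  rw [Fintype.prod_eq_mul i j hij (by rintro l ⟨hl, hl'⟩; simp [hl, hl'])] at h
  simp only [if_true, hij.symm, if_false] at h
  rw [← h]
  refine le_antisymm (patternDensity_mono ?_) (patternDensity_mono ?_)
  · intro p hp l
    by_cases hl : l = i
    · simp [hl, hp.1]
    · by_cases hl' : l = j
      · subst hl'; simp [hl, hp.2]
      · simp [hl, hl']
  · intro p hp
    have h1 := hp i
    have h2 := hp j
    simp only [if_true, hij.symm, if_false] at h1 h2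
    exact ⟨h1, h2⟩

theorem patternDensity_small_le (r t s : ℕ) :
    patternDensity (fun p : Fin r → Finset (Fin t) => ∃ i, #(p i) < s) ≤
      r * (t + 1) ^ s / 2 ^ t := by
  have := patternDensity_exists_le (fun (i : Fin r) (p : Fin r → Finset (Fin t)) => #(p i) < s)
    (c := (t + 1) ^ s / 2 ^ t) ?_
  · rwa [Fintype.card_fin, mul_div_assoc'] at this
  · intro i
    have h := patternDensity_one i (univ.filter fun P : Finset (Fin t) => #P < s)
    simp only [mem_filter, mem_univ, true_and] at h
    rw [h]
    gcongr
    have := card_filter_card_lt_le (Fin t) s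
    rw [Fintype.card_fin] at this
    exact_mod_cast this

theorem patternDensity_two_small_le (r t s q : ℕ) :
    patternDensity (fun p : Fin r → Finset (Fin t) => ∃ i j, i ≠ j ∧ #(p i) < s ∧ #(p j) < q) ≤
      (r ^ 2 * (t + 1) ^ (s + q) / 2 ^ t) / 2 ^ t := by
  have := patternDensity_exists_le
    (fun (x : Fin r × Fin r) (p : Fin r → Finset (Fin t)) =>
      x.1 ≠ x.2 ∧ #(p x.1) < s ∧ #(p x.2) < q)
    (c := ((t + 1) ^ s / 2 ^ t) * ((t + 1) ^ q / 2 ^ t)) ?_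
  · simp only [Prod.exists, Fintype.card_prod, Fintype.card_fin] at this
    refine this.trans (le_of_eq ?_)
    push_cast
    ring
  · rintro ⟨i, j⟩
    by_cases hij : i = j
    · simp only [hij, ne_eq, not_true_eq_false, false_and]
      simp only [patternDensity, filter_false, card_empty, CharP.cast_eq_zero, zero_div]
      positivity
    have h := patternDensity_two hij (univ.filter fun P : Finset (Fin t) => #P < s)
      (univ.filter fun P : Finset (Fin t) => #P < q)
    simp only [mem_filter, mem_univ, true_and] at h
    simp only [ne_eq, hij, not_false_eq_true, true_and]
    rw [h]
    have h1 := card_filter_card_lt_le (Fin t) s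
    have h2 := card_filter_card_lt_le (Fin t) q
    rw [Fintype.card_fin] at h1 h2
    gcongr
    · exact_mod_cast h1
    · exact_mod_cast h2

theorem patternDensity_inter_small_le (r t s q : ℕ) (i : Fin r) (p₀ : Fin r → Finset (Fin t))
    (hp₀ : ∀ j, j ≠ i → q ≤ #(p₀ j)) :
    patternDensity (fun p : Fin r → Finset (Fin t) =>
        #(p i) < s ∧ ∃ j, j ≠ i ∧ #(p j ∩ p₀ j) < s) ≤
      (r * (t + 1) ^ (2 * s) / 2 ^ q) / 2 ^ t := by
  have := patternDensity_exists_le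
    (fun (j : Fin r) (p : Fin r → Finset (Fin t)) =>
      j ≠ i ∧ #(p i) < s ∧ #(p j ∩ p₀ j) < s)
    (c := ((t + 1) ^ s / 2 ^ t) * ((t + 1) ^ s / 2 ^ q)) ?_
  · refine (patternDensity_mono ?_).trans (this.trans (le_of_eq ?_))
    · rintro p ⟨h1, j, h2, h3⟩
      exact ⟨j, h2, h1, h3⟩
    · rw [Fintype.card_fin]; ring
  · intro j
    by_cases hij : j = i
    · simp only [hij, ne_eq, not_true_eq_false, false_and]
      simp only [patternDensity, filter_false, card_empty, CharP.cast_eq_zero, zero_div]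
      positivity
    have h := patternDensity_two (Ne.symm hij) (univ.filter fun P : Finset (Fin t) => #P < s)
      (univ.filter fun P : Finset (Fin t) => #(P ∩ p₀ j) < s)
    simp only [mem_filter, mem_univ, true_and] at h
    simp only [ne_eq, hij, not_false_eq_true, true_and]
    rw [h]
    have h1 := card_filter_card_lt_le (Fin t) s
    have h2 := card_filter_card_inter_lt_le (p₀ j) s
    rw [Fintype.card_fin] at h1 h2
    have hc : #(p₀ j) ≤ t := by simpa using card_le_univ (p₀ j)
    refine mul_le_mul ?_ ?_ (by positivity) (by positivity)
    · gcongr; exact_mod_cast h1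
    · calc (#(univ.filter fun P : Finset (Fin t) => #(P ∩ p₀ j) < s) : ℝ) / 2 ^ t
          ≤ ((#(p₀ j) + 1) ^ s * 2 ^ (t - #(p₀ j))) / 2 ^ t := by
            gcongr; exact_mod_cast h2
        _ = (#(p₀ j) + 1) ^ s / 2 ^ #(p₀ j) := by
            rw [div_eq_div_iff (by positivity) (by positivity), mul_assoc, ← pow_add,
              Nat.sub_add_cancel hc]
        _ ≤ (t + 1) ^ s / 2 ^ q := by
            gcongr
            · norm_num
            · exact hp₀ j hij

/-- Removing the vertices of a complete multipartite subgraph. -/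
theorem gdens_le_of_nbrPattern {V : Type*} [Fintype V] {r t : ℕ} (τ : Fin r × Fin t ↪ V)
    (Q : SimpleGraph V → Prop) (H : SimpleGraph {v // v ∉ Set.range τ} → Prop)
    (P : {v // v ∉ Set.range τ} → (Fin r → Finset (Fin t)) → Prop)
    (hH : ∀ G, Q G → H (G.comap Subtype.val))
    (hP : ∀ G, Q G → ∀ u, P u (nbrPattern τ G u)) :
    gdens Q ≤ gdens H * ∏ u, patternDensity (P u) := by
  have hst : ∀ u : {v // v ∉ Set.range τ}, #(univ.image fun x => s(u.1, τ x)) = r * t := by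
    intro u
    rw [card_image_of_injective]
    · simp
    · intro x y hxy
      have hxy : s(u.1, τ x) = s(u.1, τ y) := hxy
      exact τ.injective (Sym2.congr_right.1 hxy)
  have key := gdens_le_prod_blocks Q
    ((⊤ : SimpleGraph {v // v ∉ Set.range τ}).edgeFinset.image (Sym2.map Subtype.val))
    (fun u : {v // v ∉ Set.range τ} => univ.image fun x => s(u.1, τ x)) ?_ ?_ ?_ ?_
    (fun G => G.comap (Subtype.val : {v // v ∉ Set.range τ} → V)) (univ.filter H)
    (fun (u : {v // v ∉ Set.range τ}) G => nbrPattern τ G u) (fun u => univ.filter (P u)) ?_ ?_ ?_ ?_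
  · refine key.trans (le_of_eq ?_)
    unfold gdens patternDensity
    congr 1
    · rw [card_image_of_injective _ (Sym2.map.injective Subtype.val_injective),
        SimpleGraph.card_edgeFinset_top_eq_card_choose_two]
      congr 2
      rw [← Set.ncard_coe_finset]
      congr 1
      ext G
      simp
    · refine prod_congr rfl fun u _ => ?_
      rw [hst u]
  · intro e he
    simp only [mem_image, SimpleGraph.mem_edgeFinset] at he
    obtain ⟨e, he, rfl⟩ := he
    rw [Sym2.isDiag_map Subtype.val_injective]
    exact SimpleGraph.not_isDiag_of_mem_edgeSet _ he
  · intro u e he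
    simp only [mem_image, mem_univ, true_and] at he
    obtain ⟨x, rfl⟩ := he
    rw [Sym2.mk_isDiag_iff]
    intro h
    exact u.2 ⟨x, h.symm⟩
  · intro u
    rw [disjoint_left]
    intro e he he'
    simp only [mem_image, mem_univ, true_and] at he he'
    obtain ⟨x, rfl⟩ := he'
    obtain ⟨e, -, he⟩ := he
    have : τ x ∈ Sym2.map Subtype.val e := by rw [he]; simp
    rw [Sym2.mem_map] at this
    obtain ⟨w, -, hw⟩ := this
    exact w.2 ⟨x, hw.symm⟩
  · intro u u' huu
    rw [disjoint_left]
    intro e he he'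
    simp only [mem_image, mem_univ, true_and] at he he'
    obtain ⟨x, rfl⟩ := he'
    obtain ⟨y, hy⟩ := he
    rw [Sym2.eq_iff] at hy
    rcases hy with ⟨h, -⟩ | ⟨h, -⟩
    · exact huu (Subtype.ext h)
    · exact u.2 ⟨x, h.symm⟩
  · intro G hG
    simpa using hH G hG
  · intro G hG u
    simpa using hP G hG u
  · intro G G' _ _ hGG e he heG
    simp only [mem_image, SimpleGraph.mem_edgeFinset] at he
    obtain ⟨e, he, rfl⟩ := he
    induction e with
    | h a b =>
      have := congrArg (fun K : SimpleGraph {v // v ∉ Set.range τ} => K.Adj a b) hGG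
      simp only [SimpleGraph.comap_adj, eq_iff_iff] at this
      simpa using this.1 (by simpa using heG)
  · intro G G' _ _ u hGG e he heG
    simp only [mem_image, mem_univ, true_and] at he
    obtain ⟨⟨i, a⟩, rfl⟩ := he
    rw [SimpleGraph.mem_edgeSet, ← mem_nbrPattern] at heG ⊢
    rwa [← hGG]

theorem card_compl_range {V : Type*} [Fintype V] {r t : ℕ} (τ : Fin r × Fin t ↪ V) :
    Fintype.card {v // v ∉ Set.range τ} = Fintype.card V - r * t := by
  rw [Fintype.card_subtype_compl]
  congr 1
  have := Set.card_range_of_injective τ.injective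
  simp only [Fintype.card_prod, Fintype.card_fin] at this
  rw [← this]

theorem gdens_le_of_nbrPattern_two {V : Type*} [Fintype V] {r t : ℕ} (τ : Fin r × Fin t ↪ V)
    (Q : SimpleGraph V → Prop) (H : SimpleGraph {v // v ∉ Set.range τ} → Prop)
    (A B : (Fin r → Finset (Fin t)) → Prop) (S : Finset {v // v ∉ Set.range τ}) {x y : ℝ}
    (hA : patternDensity A ≤ x) (hB : patternDensity B ≤ y)
    (hH : ∀ G, Q G → H (G.comap Subtype.val))
    (hQA : ∀ G, Q G → ∀ u, u ∉ S → A (nbrPattern τ G u))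
    (hQB : ∀ G, Q G → ∀ u, u ∈ S → B (nbrPattern τ G u)) :
    gdens Q ≤ gdens H * (x ^ (Fintype.card V - r * t - #S) * y ^ #S) := by
  refine (gdens_le_of_nbrPattern τ Q H (fun u => if u ∈ S then B else A) hH ?_).trans ?_
  · intro G hG u
    by_cases hu : u ∈ S
    · simpa [hu] using hQB G hG u hu
    · simpa [hu] using hQA G hG u hu
  · refine mul_le_mul_of_nonneg_left ?_ (gdens_nonneg _)
    calc ∏ u, patternDensity (if u ∈ S then B else A)
        ≤ ∏ u : {v // v ∉ Set.range τ}, (if u ∈ S then y else x) := by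
          refine prod_le_prod (fun _ _ => patternDensity_nonneg _) fun u _ => ?_
          split_ifs <;> assumption
      _ = _ := by
          rw [prod_ite, prod_const, prod_const, mul_comm, ← card_compl_range τ]
          congr 2
          · rw [← card_compl]
            congr 1
            ext; simp
          · congr 1
            ext; simp

theorem le_const_mul_of_recursion (p w : ℕ → ℝ) (hp : ∀ n, p n ≤ 1) (hw : ∀ n, 0 < w n) (k : ℕ)
    (hk : 0 < k) (A : ℝ)
    (h : ∀ᶠ n in atTop, p n ≤ A * w n + w n / (2 * w (n - k)) * p (n - k)) :
    ∃ C, 0 < C ∧ ∀ n, p n ≤ C * w n := by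
  obtain ⟨N₀, hN₀⟩ := eventually_atTop.1 h
  set N := max N₀ k
  have hs : 0 ≤ ∑ i ∈ range N, 1 / w i := sum_nonneg fun i _ => (one_div_pos.2 (hw i)).le
  refine ⟨2 * |A| + (∑ i ∈ range N, 1 / w i) + 1, by positivity, fun n => ?_⟩
  set C := 2 * |A| + (∑ i ∈ range N, 1 / w i) + 1
  induction n using Nat.strong_induction_on with
  | _ n ih =>
    by_cases hn : n < N
    · have h1 : 1 / w n ≤ C := by
        have := single_le_sum (f := fun i => 1 / w i) (fun i _ => (one_div_pos.2 (hw i)).le)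
          (mem_range.2 hn)
        have := abs_nonneg A
        simp only [C]; linarith
      rw [div_le_iff₀ (hw n)] at h1
      exact (hp n).trans h1
    · have hn1 : N₀ ≤ n := by omega
      have hn2 : k ≤ n := by omega
      have h1 := ih (n - k) (by omega)
      have h2 : w n / (2 * w (n - k)) * p (n - k) ≤ w n / (2 * w (n - k)) * (C * w (n - k)) := by
        have := hw n
        have := hw (n - k)
        gcongr
      have h3 : w n / (2 * w (n - k)) * (C * w (n - k)) = C / 2 * w n := by
        have := (hw (n - k)).ne'
        field_simp
      have h4 : A * w n ≤ C / 2 * w n := by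
        have := hw n
        have := le_abs_self A
        gcongr
        simp only [C]; linarith
      linarith [hN₀ n hn1]

theorem eventually_pow_mul_const_pow_le (a : ℕ) (M ρ : ℝ) (h0 : 0 ≤ ρ) (h1 : ρ < 1) {c : ℝ}
    (hc : 0 < c) : ∀ᶠ n : ℕ in atTop, ((n : ℝ) + 1) ^ a * M * ρ ^ n ≤ c := by
  have h := (tendsto_pow_const_mul_const_pow_of_abs_lt_one a
    (by rwa [abs_of_nonneg h0] : |ρ| < 1)).const_mul (2 ^ a * |M|)
  rw [mul_zero] at h
  filter_upwards [h.eventually (gt_mem_nhds hc), eventually_ge_atTop 1] with n hn hn1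
  have hn1 : (1 : ℝ) ≤ n := by exact_mod_cast hn1
  calc ((n : ℝ) + 1) ^ a * M * ρ ^ n ≤ (2 * n) ^ a * |M| * ρ ^ n := by
        refine mul_le_mul_of_nonneg_right ?_ (by positivity)
        refine (mul_le_mul_of_nonneg_left (le_abs_self M) (by positivity)).trans ?_
        refine mul_le_mul_of_nonneg_right ?_ (abs_nonneg M)
        exact pow_le_pow_left₀ (by positivity) (by linarith) a
    _ = 2 ^ a * |M| * (n ^ a * ρ ^ n) := by rw [mul_pow]; ring
    _ ≤ c := hn.le

theorem card_embedding_le (κ V : Type*) [Fintype κ] [Fintype V] :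
    Fintype.card (κ ↪ V) ≤ Fintype.card V ^ Fintype.card κ := by
  rw [Fintype.card_embedding_eq]
  exact Nat.descFactorial_le_pow _ _

theorem gdens_false {V : Type*} [Fintype V] : gdens (fun _ : SimpleGraph V => False) = 0 := by
  simp [gdens]

theorem gdens_compl_range_le {V : Type*} [Fintype V] {r t : ℕ} (τ : Fin r × Fin t ↪ V)
    (Q : SimpleGraph {v // v ∉ Set.range τ} → Prop)
    (R : SimpleGraph (Fin (Fintype.card V - r * t)) → Prop)
    (h : ∀ e : Fin (Fintype.card V - r * t) ≃ {v // v ∉ Set.range τ}, ∀ G, Q G → R (G.comap e)) :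
    gdens Q ≤ gdens R :=
  gdens_comap_equiv (Fintype.equivFinOfCardEq (card_compl_range τ)).symm _ _ (h _)

/-- If there is no complete `(r+1)`-partite subgraph, then few vertices have many neighbours in
every part of a complete `r`-partite subgraph. -/
theorem exists_small_exceptional_set {V : Type*} [Fintype V] {r t t' : ℕ}
    (G : SimpleGraph V) (hG : ¬ HasMultipartite (r + 1) t G) (τ : Fin r × Fin t' ↪ V)
    (hτ : ∀ x y, x.1 ≠ y.1 → G.Adj (τ x) (τ y)) :
    ∃ S ∈ univ.filter (fun S : Finset {v // v ∉ Set.range τ} => #S < (2 ^ t') ^ r * t + 1),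
      ∀ u ∉ S, ∃ i, #(nbrPattern τ G u i) < t := by
  refine ⟨univ.filter fun u => ∀ i, t ≤ #(nbrPattern τ G u i), ?_, ?_⟩
  · simp only [mem_filter, mem_univ, true_and]
    by_contra! hlt
    obtain ⟨p, -, hp⟩ := exists_lt_card_fiber_of_mul_lt_card_of_maps_to
      (s := univ.filter fun u : {v // v ∉ Set.range τ} => ∀ i, t ≤ #(nbrPattern τ G u i))
      (t := univ) (f := fun u => nbrPattern τ G u.1) (n := t) (fun _ _ => mem_univ _)
      (by
        have : #(univ : Finset (Fin r → Finset (Fin t'))) = (2 ^ t') ^ r := by simp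
        rw [this]; omega)
    set W := (univ.filter fun u : {v // v ∉ Set.range τ} =>
      ∀ i, t ≤ #(nbrPattern τ G u i)).filter fun u => nbrPattern τ G u.1 = p with hW
    obtain ⟨u₀, hu₀⟩ := card_pos.1 (by omega : 0 < #W)
    have hpc : ∀ i, t ≤ #(p i) := by
      simp only [hW, mem_filter, mem_univ, true_and] at hu₀
      rw [← hu₀.2]; exact hu₀.1
    have hadj : ∀ u ∈ W, ∀ i, ∀ a ∈ p i, G.Adj u.1 (τ (i, a)) := by
      intro u hu i a ha
      simp only [hW, mem_filter, mem_univ, true_and] at hu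
      rwa [← mem_nbrPattern, hu.2]
    refine hG (HasMultipartite.of_sets (Fin.cons (W.map (Function.Embedding.subtype _))
      fun i => (p i).image fun a => τ (i, a)) ?_ ?_)
    · intro i
      refine Fin.cases ?_ (fun i => ?_) i
      · simpa using hp.le
      · simp only [Fin.cons_succ]
        rw [card_image_of_injective]
        · exact hpc i
        · intro a b hab
          simpa using τ.injective hab
    · intro i j
      refine Fin.cases ?_ (fun i => ?_) i <;> refine Fin.cases ?_ (fun j => ?_) j
      · simp
      · intro _ a ha b hb
        simp only [Fin.cons_zero, Fin.cons_succ, mem_map, mem_image] at ha hb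
        obtain ⟨u, hu, rfl⟩ := ha
        obtain ⟨b, hb, rfl⟩ := hb
        exact hadj u hu j b hb
      · intro _ b hb a ha
        simp only [Fin.cons_zero, Fin.cons_succ, mem_map, mem_image] at ha hb
        obtain ⟨u, hu, rfl⟩ := ha
        obtain ⟨b, hb, rfl⟩ := hb
        exact (hadj u hu i b hb).symm
      · intro hij a ha b hb
        simp only [Fin.cons_succ, mem_image] at ha hb
        obtain ⟨a, -, rfl⟩ := ha
        obtain ⟨b, -, rfl⟩ := hb
        exact hτ _ _ fun h => hij (congrArg _ h)
  · intro u hu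
    simpa using hu

theorem gdens_small_patterns_le {V : Type*} [Fintype V] {r t t' c : ℕ} {x : ℝ} (hx0 : 0 < x)
    (hx1 : x ≤ 1) (hx : (r * (t' + 1) ^ t / 2 ^ t' : ℝ) ≤ x) (τ : Fin r × Fin t' ↪ V)
    (S : Finset {v // v ∉ Set.range τ}) (hS : #S < c + 1) :
    gdens (fun G : SimpleGraph V => ¬ HasMultipartite (r + 1) t G ∧
        ∀ u ∉ S, ∃ i, #(nbrPattern τ G u i) < t) ≤
      gdens (fun G : SimpleGraph (Fin (Fintype.card V - r * t')) => ¬ HasMultipartite (r + 1) t G) *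
        (x ^ Fintype.card V * (1 / x ^ (r * t' + c))) := by
  have h := gdens_le_of_nbrPattern_two τ (fun G : SimpleGraph V => ¬ HasMultipartite (r + 1) t G ∧
        ∀ u ∉ S, ∃ i, #(nbrPattern τ G u i) < t)
    (fun G => ¬ HasMultipartite (r + 1) t G) (fun p => ∃ i, #(p i) < t) (fun _ => True) S
    (x := x) (y := 1) ((patternDensity_small_le r t' t).trans hx) ?_
    (fun G hG hM => hG.1 (hM.of_comap (Function.Embedding.subtype _)))
    (fun G hG u hu => hG.2 u hu) (fun _ _ _ _ => trivial)
  · rw [one_pow, mul_one] at h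
    refine h.trans ?_
    have h1 := gdens_compl_range_le τ (fun G => ¬ HasMultipartite (r + 1) t G)
      (fun G => ¬ HasMultipartite (r + 1) t G) fun e G hG hM => hG (hM.of_comap e.toEmbedding)
    have h2 : x ^ (Fintype.card V - r * t' - #S) ≤
        x ^ Fintype.card V * (1 / x ^ (r * t' + c)) := by
      rw [mul_one_div, le_div_iff₀ (by positivity), ← pow_add]
      exact pow_le_pow_of_le_one hx0.le hx1 (by omega)
    exact mul_le_mul h1 h2 (by positivity) (gdens_nonneg _)
  · have h := patternDensity_pi fun _ : Fin r => (univ : Finset (Finset (Fin t')))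
    simpa using h.le

/-- Recursion step for graphs without complete `(r+1)`-partite subgraphs. -/
theorem gdens_multipartite_step {V : Type*} [Fintype V] (r t t' : ℕ) {x : ℝ} (hx0 : 0 < x)
    (hx1 : x ≤ 1) (hx : (r * (t' + 1) ^ t / 2 ^ t' : ℝ) ≤ x) :
    gdens (fun G : SimpleGraph V => ¬ HasMultipartite (r + 1) t G) ≤
      gdens (fun G : SimpleGraph V => ¬ HasMultipartite r t' G) +
      ((Fintype.card V : ℝ) + 1) ^ (r * t' + (2 ^ t') ^ r * t + 1) *
        (1 / x ^ (r * t' + (2 ^ t') ^ r * t)) * x ^ Fintype.card V *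
        gdens (fun G : SimpleGraph (Fin (Fintype.card V - r * t')) =>
          ¬ HasMultipartite (r + 1) t G) := by
  set c := (2 ^ t') ^ r * t with hc
  set n := Fintype.card V with hn
  set P := gdens (fun G : SimpleGraph (Fin (n - r * t')) => ¬ HasMultipartite (r + 1) t G)
  have hP0 : 0 ≤ P := gdens_nonneg _
  have hstep : gdens (fun G : SimpleGraph V => ¬ HasMultipartite (r + 1) t G) ≤
      gdens (fun G : SimpleGraph V => ¬ HasMultipartite r t' G) +
      gdens (fun G : SimpleGraph V => ∃ τ : Fin r × Fin t' ↪ V, ∃ S ∈ univ.filter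
        (fun S : Finset {v // v ∉ Set.range τ} => #S < c + 1), ¬ HasMultipartite (r + 1) t G ∧
          ∀ u ∉ S, ∃ i, #(nbrPattern τ G u i) < t) := by
    refine le_trans (gdens_mono fun G hG => ?_) (gdens_or_le _ _)
    by_cases h : HasMultipartite r t' G
    · obtain ⟨τ, hτ⟩ := h
      obtain ⟨S, hS, hS'⟩ := exists_small_exceptional_set G hG τ hτ
      exact Or.inr ⟨τ, S, hS, hG, hS'⟩
    · exact Or.inl h
  refine hstep.trans (add_le_add le_rfl ?_)
  refine (gdens_exists_le _ (c := ((n : ℝ) + 1) ^ (c + 1) *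
    (P * (x ^ n * (1 / x ^ (r * t' + c))))) fun τ => ?_).trans ?_
  · refine (gdens_exists_mem_le _ _ fun S hS => gdens_small_patterns_le hx0 hx1 hx τ S
      (mem_filter.1 hS).2).trans ?_
    refine mul_le_mul_of_nonneg_right ?_ (by positivity)
    have h1 := card_filter_card_lt_le {v // v ∉ Set.range τ} (c + 1)
    rw [card_compl_range] at h1
    have h2 : (Fintype.card V - r * t' + 1) ^ (c + 1) ≤ (n + 1) ^ (c + 1) :=
      Nat.pow_le_pow_left (by omega) _
    exact_mod_cast h1.trans h2
  · have h3 : (Fintype.card (Fin r × Fin t' ↪ V) : ℝ) ≤ ((n : ℝ) + 1) ^ (r * t') := by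
      have := card_embedding_le (Fin r × Fin t') V
      simp only [Fintype.card_prod, Fintype.card_fin] at this
      calc (Fintype.card (Fin r × Fin t' ↪ V) : ℝ) ≤ (n : ℝ) ^ (r * t') := by exact_mod_cast this
        _ ≤ _ := by gcongr; linarith
    refine (mul_le_mul_of_nonneg_right h3 (by positivity)).trans (le_of_eq ?_)
    ring

theorem gdens_not_hasMultipartite_le (r t : ℕ) (β : ℝ) (hβ0 : 0 ≤ β) (hβ : 2 * r * β < 1) :
    ∃ C : ℝ, 0 < C ∧ ∀ (V : Type) [Fintype V],
      gdens (fun G : SimpleGraph V => ¬ HasMultipartite (r + 1) t G) ≤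
        C * 2 ^ (-β * (Fintype.card V : ℝ) ^ 2) := by
  suffices H : ∃ C : ℝ, 0 < C ∧ ∀ n : ℕ,
      gdens (fun G : SimpleGraph (Fin n) => ¬ HasMultipartite (r + 1) t G) ≤
        C * 2 ^ (-β * (n : ℝ) ^ 2) by
    obtain ⟨C, hC, h⟩ := H
    refine ⟨C, hC, fun V _ => (gdens_comap_equiv (Fintype.equivFin V).symm _ _ ?_).trans
      (h (Fintype.card V))⟩
    exact fun G hG hM => hG (hM.of_comap (Fintype.equivFin V).symm.toEmbedding)
  induction r generalizing t with
  | zero =>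
    refine ⟨2 ^ (β * (t : ℝ) ^ 2), by positivity, fun n => ?_⟩
    by_cases hn : t ≤ n
    · have : gdens (fun G : SimpleGraph (Fin n) => ¬ HasMultipartite (0 + 1) t G) ≤
          gdens (fun _ : SimpleGraph (Fin n) => False) := by
        refine gdens_mono fun G hG => hG ?_
        refine HasMultipartite.of_sets (fun _ => univ) (by simpa using hn) ?_
        intro i j hij
        exact absurd (Subsingleton.elim (α := Fin 1) i j) hij
      refine this.trans ?_
      rw [gdens_false]
      positivity
    · refine (gdens_le_one _).trans ?_
      rw [← Real.rpow_add (by norm_num)]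
      refine Real.one_le_rpow (by norm_num) ?_
      have : (n : ℝ) ^ 2 ≤ (t : ℝ) ^ 2 := by gcongr; omega
      nlinarith
  | succ r ih =>
    by_cases ht0 : t = 0
    · refine ⟨1, one_pos, fun n => ?_⟩
      have : gdens (fun G : SimpleGraph (Fin n) => ¬ HasMultipartite (r + 1 + 1) t G) ≤
          gdens (fun _ : SimpleGraph (Fin n) => False) := by
        refine gdens_mono fun G hG => hG ?_
        refine HasMultipartite.of_sets (fun _ => ∅) (by simp [ht0]) ?_
        intro i j hij a ha
        simp at ha
      refine this.trans ?_
      rw [gdens_false]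
      positivity
    have ht0 : 0 < t := by omega
    push_cast at hβ
    have hρ : (2 : ℝ) ^ (2 * (r + 1) * β - 1) < 1 :=
      Real.rpow_lt_one_of_one_lt_of_neg (by norm_num) (by linarith)
    obtain ⟨t', ht'1, ht'⟩ := ((eventually_pow_mul_const_pow_le t ((r + 1 : ℕ) : ℝ) _ (by positivity) hρ
      (by norm_num : (0 : ℝ) < 1 / 2)).and (eventually_ge_atTop 1)).exists
    set x : ℝ := (r + 1 : ℕ) * (t' + 1) ^ t / 2 ^ t' with hxdef
    have hx0 : 0 < x := by positivity
    set k := (r + 1) * t' with hk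
    have hxρ : x * 2 ^ (2 * β * k) ≤ 1 / 2 := by
      refine le_trans (le_of_eq ?_) ht'1
      rw [hxdef, ← Real.rpow_natCast ((2 : ℝ) ^ (2 * ((r : ℝ) + 1) * β - 1)) t',
        ← Real.rpow_mul (by norm_num), sub_mul, sub_eq_add_neg,
        Real.rpow_add (by norm_num), one_mul, Real.rpow_neg (by norm_num), Real.rpow_natCast 2 t',
        hk]
      push_cast
      field_simp
    have hx1 : x ≤ 1 := by
      have : (1 : ℝ) ≤ 2 ^ (2 * β * k) := Real.one_le_rpow (by norm_num) (by positivity)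
      linarith [le_mul_of_one_le_right hx0.le this]
    obtain ⟨C₁, hC₁, hIH⟩ := ih t' (by
      nlinarith)
    refine le_const_mul_of_recursion _ (fun n => (2 : ℝ) ^ (-β * (n : ℝ) ^ 2))
      (fun n => gdens_le_one _) (fun n => by positivity) k (by positivity) C₁ ?_
    filter_upwards [eventually_pow_mul_const_pow_le (k + (2 ^ t') ^ (r + 1) * t + 1)
      (1 / x ^ (k + (2 ^ t') ^ (r + 1) * t)) (x * 2 ^ (2 * β * k)) (by positivity)
      (by linarith) (by norm_num : (0 : ℝ) < 1 / 2), eventually_ge_atTop k] with n hn hnk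
    have hst := gdens_multipartite_step (V := Fin n) (r + 1) t t' hx0 hx1 le_rfl
    rw [Fintype.card_fin] at hst
    refine hst.trans (add_le_add (hIH n) ?_)
    refine mul_le_mul_of_nonneg_right ?_ (gdens_nonneg _)
    have h1 : (2 : ℝ) ^ (-β * (n : ℝ) ^ 2) / (2 * 2 ^ (-β * ((n - k : ℕ) : ℝ) ^ 2)) =
        1 / 2 * (2 : ℝ) ^ (-(2 * β * k * n) + β * k ^ 2) := by
      rw [mul_comm (2 : ℝ) (2 ^ _), ← div_div, ← Real.rpow_sub (by norm_num), Nat.cast_sub hnk]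
      rw [div_eq_mul_one_div, mul_comm]
      congr 2
      ring
    rw [h1]
    have h2 : (2 : ℝ) ^ (-(2 * β * k * n)) ≤ (2 : ℝ) ^ (-(2 * β * k * n) + β * k ^ 2) :=
      Real.rpow_le_rpow_of_exponent_le (by norm_num) (by nlinarith [sq_nonneg (k : ℝ)])
    refine le_trans ?_ (mul_le_mul_of_nonneg_left h2 (by norm_num))
    rw [Real.rpow_neg (by norm_num), ← div_eq_mul_inv, le_div_iff₀ (by positivity)]
    refine le_trans (le_of_eq ?_) hn
    rw [mul_pow, ← Real.rpow_natCast (2 ^ (2 * β * (k : ℝ))), ← Real.rpow_mul (by norm_num)]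
    ring

/-- The ordered pairs of adjacent vertices with the same colour. -/
noncomputable def monoPairs {V ι : Type*} [Fintype V] (G : SimpleGraph V) (c : V → ι) :
    Finset (V × V) :=
  univ.filter fun x => G.Adj x.1 x.2 ∧ c x.1 = c x.2

/-- `G` has an `r`-colouring with at most `4n²/D` ordered monochromatic adjacent pairs. -/
def IsClose {V : Type*} [Fintype V] (r D : ℕ) (G : SimpleGraph V) : Prop :=
  ∃ c : V → Fin r, D * #(monoPairs G c) ≤ 4 * Fintype.card V ^ 2

/-- The families of unlikely neighbourhood patterns: patterns with two sparse parts, and patterns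
that are sparse on part `i` and nearly disjoint from `p₀` on some other part. -/
def RarePattern {r t : ℕ} (s q : ℕ) :
    Option (Fin r × (Fin r → Finset (Fin t))) → (Fin r → Finset (Fin t)) → Prop
  | none, p => ∃ i j, i ≠ j ∧ #(p i) < s ∧ #(p j) < q
  | some (i, p₀), p =>
      (∀ j, j ≠ i → q ≤ #(p₀ j)) ∧ #(p i) < s ∧ ∃ j, j ≠ i ∧ #(p j ∩ p₀ j) < s

theorem patternDensity_rarePattern_le {r t s q : ℕ} {l : ℝ}
    (h1 : (r ^ 2 * (t + 1) ^ (s + q) / 2 ^ t : ℝ) ≤ l)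
    (h2 : (r * (t + 1) ^ (2 * s) / 2 ^ q : ℝ) ≤ l)
    (idx : Option (Fin r × (Fin r → Finset (Fin t)))) :
    patternDensity (RarePattern s q idx) ≤ l / 2 ^ t := by
  rcases idx with _ | ⟨i, p₀⟩
  · refine (patternDensity_two_small_le r t s q).trans ?_
    gcongr
  · by_cases hp : ∀ j, j ≠ i → q ≤ #(p₀ j)
    · refine le_trans (patternDensity_mono fun p hp => hp.2)
        ((patternDensity_inter_small_le r t s q i p₀ hp).trans ?_)
      gcongr
    · have h0 : (0 : ℝ) ≤ l := le_trans (by positivity) h1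
      have : patternDensity (RarePattern s q (some (i, p₀))) ≤ 0 := by
        have he : univ.filter (RarePattern (r := r) (t := t) s q (some (i, p₀))) = ∅ :=
          filter_eq_empty_iff.2 fun p _ h => hp h.1
        simp [patternDensity, he]
      exact this.trans (by positivity)

theorem exists_sparse_part {V : Type*} {r s t : ℕ} (hr : 0 < r) (hs : 0 < s) {G : SimpleGraph V}
    (hG : ¬ HasPlus r s G) (τ : Fin r × Fin t ↪ V)
    (hτ : ∀ x y, x.1 ≠ y.1 → G.Adj (τ x) (τ y)) (v : V) :
    ∃ i, #(nbrPattern τ G v i) < s := by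
  by_contra! h
  let i₀ : Fin r := ⟨0, hr⟩
  have hN : ∀ j, ∀ a ∈ (nbrPattern τ G v j).image (fun a => τ (j, a)), G.Adj v a := by
    intro j a ha
    obtain ⟨a, ha, rfl⟩ := mem_image.1 ha
    rwa [← mem_nbrPattern]
  have hc : ∀ j, s ≤ #((nbrPattern τ G v j).image (fun a => τ (j, a))) := by
    intro j
    rw [card_image_of_injective _ fun a b hab => by simpa using τ.injective hab]
    exact h j
  have hT : ∀ i j, i ≠ j → ∀ a ∈ (nbrPattern τ G v i).image (fun a => τ (i, a)),
      ∀ b ∈ (nbrPattern τ G v j).image (fun a => τ (j, a)), G.Adj a b := by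
    intro i j hij a ha b hb
    obtain ⟨a, -, rfl⟩ := mem_image.1 ha
    obtain ⟨b, -, rfl⟩ := mem_image.1 hb
    exact hτ _ _ hij
  obtain ⟨a, ha⟩ := card_pos.1 (hs.trans_le (hc i₀))
  refine hG ⟨fun j => if j = i₀ then insert v ((nbrPattern τ G v j).image (fun a => τ (j, a)))
    else (nbrPattern τ G v j).image (fun a => τ (j, a)), ?_, ?_, i₀, v, by simp, a, ?_, hN i₀ a ha⟩
  · intro j
    dsimp only
    split_ifs
    · exact (hc j).trans (card_le_card (subset_insert _ _))
    · exact hc j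
  · intro i j hij a ha b hb
    dsimp only at ha hb
    split_ifs at ha hb with h1 h2 h2
    · exact absurd (h1.trans h2.symm) hij
    · rcases mem_insert.1 ha with rfl | ha
      exacts [hN j b hb, hT i j hij a ha b hb]
    · rcases mem_insert.1 hb with rfl | hb
      exacts [(hN i a ha).symm, hT i j hij a ha b hb]
    · exact hT i j hij a ha b hb
  · simpa using Or.inr (by simpa using ha)

theorem exists_small_inter {V : Type*} {r s t : ℕ} (hst : s ≤ t) {G : SimpleGraph V}
    (hG : ¬ HasPlus r s G) (τ : Fin r × Fin t ↪ V)
    (hτ : ∀ x y, x.1 ≠ y.1 → G.Adj (τ x) (τ y)) {v w : V} (hvw : G.Adj v w) (i : Fin r) :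
    ∃ j, j ≠ i ∧ #(nbrPattern τ G w j ∩ nbrPattern τ G v j) < s := by
  by_contra! h
  set P : Fin r → Finset (Fin t) := fun j => nbrPattern τ G w j ∩ nbrPattern τ G v j with hP
  have hN : ∀ j, ∀ a ∈ (P j).image (fun a => τ (j, a)), G.Adj v a ∧ G.Adj w a := by
    intro j a ha
    obtain ⟨a, ha', rfl⟩ := mem_image.1 ha
    have ha' := mem_inter.1 ha'
    rw [← mem_nbrPattern, ← mem_nbrPattern]
    exact ha'.symm
  have hinj : ∀ j : Fin r, Function.Injective fun a : Fin t => τ (j, a) :=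
    fun j a b hab => by simpa using τ.injective hab
  set T : Finset V := insert v (insert w (univ.image fun a => τ (i, a))) with hTd
  have hT : ∀ j, j ≠ i → ∀ a ∈ T, ∀ b ∈ (P j).image (fun a => τ (j, a)), G.Adj a b := by
    intro j hj a ha b hb
    simp only [hTd, mem_insert, mem_image, mem_univ, true_and] at ha
    rcases ha with rfl | rfl | ⟨a, rfl⟩
    · exact (hN j b hb).1
    · exact (hN j b hb).2
    · obtain ⟨b, -, rfl⟩ := mem_image.1 hb
      exact hτ _ _ hj.symm
  refine hG ⟨fun j => if j = i then T else (P j).image (fun a => τ (j, a)), ?_, ?_, i, v,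
    by simp [hTd], w, by simp [hTd], hvw⟩
  · intro j
    dsimp only
    split_ifs with hj
    · refine le_trans ?_ (card_le_card (s := univ.image fun a => τ (i, a)) ?_)
      · rw [card_image_of_injective _ (hinj i)]; simpa using hst
      · exact (subset_insert _ _).trans (subset_insert _ _)
    · rw [card_image_of_injective _ (hinj j)]
      exact h j hj
  · intro j l hjl a ha b hb
    dsimp only at ha hb
    split_ifs at ha hb with h1 h2 h2
    · exact absurd (h1.trans h2.symm) hjl
    · exact hT l h2 a ha b hb
    · exact (hT j h1 b hb a ha).symm
    · obtain ⟨a, -, rfl⟩ := mem_image.1 ha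
      obtain ⟨b, -, rfl⟩ := mem_image.1 hb
      exact hτ _ _ hjl

/-- A graph without the configuration `HasPlus` that is not close to `r`-partite has many vertices
whose patterns share a rare family. -/
theorem exists_many_rare {V : Type*} [Fintype V] {r s t q D : ℕ} (hr : 0 < r) (hs : 0 < s)
    (hst : s ≤ t) (hV : 2 * D * (r * t) ≤ Fintype.card V) {G : SimpleGraph V}
    (hG : ¬ HasPlus r s G) (hD : ¬ IsClose r D G) (τ : Fin r × Fin t ↪ V)
    (hτ : ∀ x y, x.1 ≠ y.1 → G.Adj (τ x) (τ y)) :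
    ∃ idx, ∃ S : Finset {v // v ∉ Set.range τ}, Fintype.card V ≤ D * #S ∧
      ∀ u ∈ S, RarePattern s q idx (nbrPattern τ G u) := by
  by_contra! hcon
  set n := Fintype.card V
  set S : Option (Fin r × (Fin r → Finset (Fin t))) → Finset {v // v ∉ Set.range τ} := fun idx =>
    univ.filter fun u => RarePattern s q idx (nbrPattern τ G u) with hS
  have hSn : ∀ idx, D * #(S idx) < n := by
    intro idx
    by_contra! h
    obtain ⟨u, hu, hu'⟩ := hcon idx (S idx) h
    exact hu' (mem_filter.1 hu).2
  choose c hc using fun v => exists_sparse_part hr hs hG τ hτ v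
  set Z : Finset V := univ.map τ ∪ (S none).map (Function.Embedding.subtype _) with hZ
  have hZc : D * #Z ≤ D * (r * t) + n := by
    have h1 : #Z ≤ r * t + #(S none) := by
      refine (card_union_le _ _).trans ?_
      simp
    have h2 := hSn none
    nlinarith
  have hrow : ∀ v, v ∉ Z →
      D * #(univ.filter fun w => G.Adj v w ∧ c v = c w ∧ w ∉ Z) ≤ n := by
    intro v hv
    refine le_trans (Nat.mul_le_mul_left _ ?_) (hSn (some (c v, nbrPattern τ G v))).le
    rw [← card_map (Function.Embedding.subtype _)]
    refine card_le_card ?_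
    intro w hw
    simp only [mem_filter, mem_univ, true_and] at hw
    obtain ⟨hvw, hcw, hw⟩ := hw
    have hns : ∀ v, v ∉ Z → ∃ _ : v ∉ Set.range τ, ¬ RarePattern s q none (nbrPattern τ G v) := by
      intro v hv
      simp only [hZ, hS, mem_union, mem_map, mem_univ, true_and, mem_filter, not_or] at hv
      refine ⟨hv.1, fun h => hv.2 ⟨⟨v, hv.1⟩, h, rfl⟩⟩
    obtain ⟨hv1, hv2⟩ := hns v hv
    obtain ⟨hw1, hw2⟩ := hns w hw
    simp only [mem_map]
    refine ⟨⟨w, hw1⟩, ?_, rfl⟩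
    simp only [hS, mem_filter, mem_univ, true_and]
    refine ⟨?_, ?_, exists_small_inter hst hG τ hτ hvw (c v)⟩
    · intro j hj
      by_contra! hlt
      exact hv2 ⟨c v, j, hj.symm, hc v, hlt⟩
    · rw [hcw]; exact hc w
  refine hD ⟨c, ?_⟩
  have hsub : monoPairs G c ⊆ (Z ×ˢ univ ∪ univ ×ˢ Z) ∪
      (univ.filter fun v => v ∉ Z).biUnion
        fun v => (univ.filter fun w => G.Adj v w ∧ c v = c w ∧ w ∉ Z).image fun w => (v, w) := by
    rintro ⟨v, w⟩ hvw
    simp only [monoPairs, mem_filter, mem_univ, true_and] at hvw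
    by_cases hv : v ∈ Z
    · simp [hv]
    by_cases hw : w ∈ Z
    · simp [hw]
    simp [hv, hw, hvw]
  have h1 := card_le_card hsub
  have h2 : #((univ.filter fun v => v ∉ Z).biUnion
      fun v => (univ.filter fun w => G.Adj v w ∧ c v = c w ∧ w ∉ Z).image fun w => (v, w)) ≤
      ∑ v ∈ univ.filter (fun v => v ∉ Z),
        #(univ.filter fun w => G.Adj v w ∧ c v = c w ∧ w ∉ Z) :=
    card_biUnion_le.trans (sum_le_sum fun v _ => card_image_le)
  have h3 : D * ∑ v ∈ univ.filter (fun v => v ∉ Z),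
        #(univ.filter fun w => G.Adj v w ∧ c v = c w ∧ w ∉ Z) ≤ n * n := by
    rw [mul_sum]
    refine (sum_le_card_nsmul _ _ n fun v hv => hrow v (mem_filter.1 hv).2).trans ?_
    rw [smul_eq_mul]
    exact Nat.mul_le_mul_right _ (card_le_univ _)
  have h4 : #(Z ×ˢ (univ : Finset V) ∪ univ ×ˢ Z) ≤ 2 * (n * #Z) := by
    refine (card_union_le _ _).trans ?_
    rw [card_product, card_product, card_univ]
    exact le_of_eq (by ring)
  have h5 := card_union_le (Z ×ˢ (univ : Finset V) ∪ univ ×ˢ Z) ((univ.filter fun v => v ∉ Z).biUnion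
        fun v => (univ.filter fun w => G.Adj v w ∧ c v = c w ∧ w ∉ Z).image fun w => (v, w))
  have h6 : #(monoPairs G c) ≤ 2 * (n * #Z) + ∑ v ∈ univ.filter (fun v => v ∉ Z),
        #(univ.filter fun w => G.Adj v w ∧ c v = c w ∧ w ∉ Z) := by omega
  calc D * #(monoPairs G c) ≤ D * (2 * (n * #Z) + ∑ v ∈ univ.filter (fun v => v ∉ Z),
        #(univ.filter fun w => G.Adj v w ∧ c v = c w ∧ w ∉ Z)) := Nat.mul_le_mul_left _ h6
    _ = 2 * n * (D * #Z) + D * ∑ v ∈ univ.filter (fun v => v ∉ Z),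
        #(univ.filter fun w => G.Adj v w ∧ c v = c w ∧ w ∉ Z) := by ring
    _ ≤ 2 * n * (D * (r * t) + n) + n * n := by gcongr
    _ ≤ 4 * n ^ 2 := by nlinarith

theorem exists_pattern_parameters (r s D : ℕ) (hr : 0 < r) :
    ∃ t q : ℕ, s ≤ t ∧ ∃ L l : ℝ, 1 ≤ L ∧ (r * (t + 1) ^ s : ℝ) ≤ L ∧ 0 < l ∧
      (r ^ 2 * (t + 1) ^ (s + q) / 2 ^ t : ℝ) ≤ l ∧ (r * (t + 1) ^ (2 * s) / 2 ^ q : ℝ) ≤ l ∧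
      l * (4 * L) ^ D = 1 := by
  set M := 2 * r + s + (r + 2 * s + (2 + r) * D + s * D) + (2 + r) * D + s * D + 1 + s with hM
  obtain ⟨u, hu⟩ := (eventually_pow_mul_const_pow_le 2 M (1 / 2) (by norm_num) (by norm_num)
    one_pos).exists
  have hu : (u + 1) ^ 2 * M ≤ 2 ^ u := by
    rw [one_div, inv_pow, ← div_eq_mul_inv, div_le_one (by positivity)] at hu
    exact_mod_cast hu
  set q := r + 2 * u * s + (2 + r) * D + u * s * D with hq
  have h1 : 2 * r + u * (s + q) + (2 + r) * D + u * s * D + 1 + s ≤ 2 ^ u := by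
    refine le_trans ?_ hu
    rw [hM, hq]
    have e1 : 1 ≤ (u + 1) ^ 2 := Nat.one_le_pow _ _ (by omega)
    have e2 : u ≤ (u + 1) ^ 2 := by nlinarith
    have e3 : u * u ≤ (u + 1) ^ 2 := by nlinarith
    have m1 := Nat.mul_le_mul_right (2 * r + (2 + r) * D + 1 + s) e1
    have m2 := Nat.mul_le_mul_right (s + (r + (2 + r) * D) + s * D) e2
    have m3 := Nat.mul_le_mul_right (2 * s + s * D) e3
    nlinarith
  have hr2 : (r : ℝ) ≤ 2 ^ r := by exact_mod_cast Nat.lt_two_pow_self.le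
  have hr1 : (1 : ℝ) ≤ r := by exact_mod_cast hr
  have hE : (4 * (r * (2 ^ u) ^ s) : ℝ) ^ D ≤ 2 ^ ((2 + r) * D + u * s * D) := by
    calc (4 * (r * (2 ^ u) ^ s) : ℝ) ^ D ≤ (4 * (2 ^ r * (2 ^ u) ^ s)) ^ D := by gcongr
      _ = (2 ^ (2 + r + u * s)) ^ D := by rw [pow_add, pow_add, pow_mul]; norm_num; ring
      _ = _ := by rw [← pow_mul]; congr 1; ring
  have ht : ((2 ^ u - 1 : ℕ) : ℝ) + 1 = 2 ^ u := by
    rw [Nat.cast_sub Nat.one_le_two_pow]; push_cast; ring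
  refine ⟨2 ^ u - 1, q, by omega, r * (2 ^ u) ^ s, 1 / (4 * (r * (2 ^ u) ^ s)) ^ D, ?_, ?_, ?_, ?_,
    ?_, ?_⟩
  · exact one_le_mul_of_one_le_of_one_le hr1 (one_le_pow₀ (one_le_pow₀ (by norm_num)))
  · rw [ht]
  · positivity
  · rw [ht, div_le_div_iff₀ (by positivity) (by positivity), one_mul]
    calc (r : ℝ) ^ 2 * (2 ^ u) ^ (s + q) * (4 * (r * (2 ^ u) ^ s)) ^ D
        ≤ (2 ^ r) ^ 2 * (2 ^ u) ^ (s + q) * 2 ^ ((2 + r) * D + u * s * D) := by gcongr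
      _ = 2 ^ (2 * r + u * (s + q) + ((2 + r) * D + u * s * D)) := by
        rw [← pow_mul, ← pow_mul, ← pow_add, ← pow_add, mul_comm r 2]
      _ ≤ 2 ^ (2 ^ u - 1) := pow_le_pow_right₀ (by norm_num) (by omega)
  · rw [ht, div_le_div_iff₀ (by positivity) (by positivity), one_mul]
    calc (r : ℝ) * (2 ^ u) ^ (2 * s) * (4 * (r * (2 ^ u) ^ s)) ^ D
        ≤ 2 ^ r * (2 ^ u) ^ (2 * s) * 2 ^ ((2 + r) * D + u * s * D) := by gcongr
      _ = 2 ^ q := by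
        rw [← pow_mul, ← pow_add, ← pow_add, hq]; congr 1; ring
  · exact one_div_mul_cancel (by positivity)

theorem gdens_rare_le {V : Type*} [Fintype V] {r s t q D : ℕ} {L l : ℝ} (hL : 1 ≤ L)
    (hL' : (r * (t + 1) ^ s : ℝ) ≤ L) (hl : 0 < l)
    (h1 : (r ^ 2 * (t + 1) ^ (s + q) / 2 ^ t : ℝ) ≤ l)
    (h2 : (r * (t + 1) ^ (2 * s) / 2 ^ q : ℝ) ≤ l) (hlL : l * (4 * L) ^ D = 1)
    (τ : Fin r × Fin t ↪ V) (idx : Option (Fin r × (Fin r → Finset (Fin t))))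
    (S : Finset {v // v ∉ Set.range τ}) (hS : Fintype.card V ≤ D * #S) :
    gdens (fun G : SimpleGraph V => ¬ HasPlus r s G ∧ (∀ u, ∃ i, #(nbrPattern τ G u i) < s) ∧
        ∀ u ∈ S, RarePattern s q idx (nbrPattern τ G u)) ≤
      gdens (fun G : SimpleGraph (Fin (Fintype.card V - r * t)) => ¬ HasPlus r s G) *
        ((1 / 2) ^ (t * (Fintype.card V - r * t)) * (1 / 4) ^ Fintype.card V) := by
  have h := gdens_le_of_nbrPattern_two τ (fun G : SimpleGraph V => ¬ HasPlus r s G ∧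
      (∀ u, ∃ i, #(nbrPattern τ G u i) < s) ∧ ∀ u ∈ S, RarePattern s q idx (nbrPattern τ G u))
    (fun G => ¬ HasPlus r s G) (fun p => ∃ i, #(p i) < s) (RarePattern s q idx) S
    (x := L / 2 ^ t) (y := l / 2 ^ t)
    ((patternDensity_small_le r t s).trans (by gcongr)) (patternDensity_rarePattern_le h1 h2 idx)
    (fun G hG hM => hG.1 (hM.of_comap (Function.Embedding.subtype _)))
    (fun G hG u _ => hG.2.1 u) (fun G hG u hu => hG.2.2 u hu)
  refine h.trans ?_
  have hSc : #S ≤ Fintype.card V - r * t := by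
    rw [← card_compl_range τ]; exact card_le_univ S
  set n := Fintype.card V
  refine mul_le_mul (gdens_compl_range_le τ (fun G => ¬ HasPlus r s G)
    (fun G => ¬ HasPlus r s G) fun e G hG hM => hG (hM.of_comap e.toEmbedding)) ?_ (by positivity)
    (gdens_nonneg _)
  have e1 : (L / 2 ^ t) ^ (n - r * t - #S) * (l / 2 ^ t) ^ #S =
      (1 / 2) ^ (t * (n - r * t)) * (L ^ (n - r * t - #S) * l ^ #S) := by
    obtain ⟨d, hd⟩ := Nat.exists_eq_add_of_le hSc
    rw [hd, Nat.add_sub_cancel_left, div_pow, div_pow, one_div, inv_pow, pow_mul, pow_add]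
    field_simp
  rw [e1]
  refine mul_le_mul_of_nonneg_left ?_ (by positivity)
  have e2 : l ^ #S * (4 * L) ^ (D * #S) = 1 := by
    rw [pow_mul, ← mul_pow, hlL, one_pow]
  have e3 : l ^ #S * (4 * L) ^ n ≤ 1 := by
    rw [← e2]
    gcongr
    linarith
  rw [one_div, inv_pow, ← one_div, le_div_iff₀ (by positivity)]
  calc L ^ (n - r * t - #S) * l ^ #S * 4 ^ n ≤ L ^ n * l ^ #S * 4 ^ n := by
        gcongr
        omega
    _ = l ^ #S * (4 * L) ^ n := by rw [mul_pow]; ring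
    _ ≤ 1 := e3

theorem gdens_not_close_le (r s D : ℕ) (hr : 0 < r) (hs : 0 < s) :
    ∃ t : ℕ, s ≤ t ∧ ∀ (V : Type) [Fintype V], 2 * D * (r * t) ≤ Fintype.card V →
      gdens (fun G : SimpleGraph V =>
          ¬ HasPlus r s G ∧ HasMultipartite r t G ∧ ¬ IsClose r D G) ≤
        ((Fintype.card V : ℝ) + 1) ^ (r * t) * (r * 2 ^ (r * t) + 1) *
          (1 / 2) ^ Fintype.card V * ((1 / 2) ^ (t * (Fintype.card V - r * t)) *
          gdens (fun G : SimpleGraph (Fin (Fintype.card V - r * t)) => ¬ HasPlus r s G)) := by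
  obtain ⟨t, q, hst, L, l, hL, hL', hl, h1, h2, hlL⟩ := exists_pattern_parameters r s D hr
  refine ⟨t, hst, fun V _ hV => ?_⟩
  set n := Fintype.card V with hn
  set P := gdens (fun G : SimpleGraph (Fin (n - r * t)) => ¬ HasPlus r s G)
  have hP : 0 ≤ P := gdens_nonneg _
  refine (gdens_mono (R := fun G => ∃ τ : Fin r × Fin t ↪ V, ∃ idx,
    ∃ S ∈ univ.filter (fun S : Finset {v // v ∉ Set.range τ} => n ≤ D * #S),
      ¬ HasPlus r s G ∧ (∀ u, ∃ i, #(nbrPattern τ G u i) < s) ∧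
        ∀ u ∈ S, RarePattern s q idx (nbrPattern τ G u)) ?_).trans ?_
  · rintro G ⟨hG, ⟨τ, hτ⟩, hD⟩
    obtain ⟨idx, S, hS, hR⟩ := exists_many_rare (q := q) hr hs hst hV hG hD τ hτ
    exact ⟨τ, idx, S, by simpa using hS, hG, exists_sparse_part hr hs hG τ hτ, hR⟩
  refine (gdens_exists_le _ fun τ => gdens_exists_le _ fun idx => (gdens_exists_mem_le _ _
    fun S hS => gdens_rare_le hL hL' hl h1 h2 hlL τ idx S (mem_filter.1 hS).2).trans
    (?_ : _ ≤ 2 ^ n * (P * ((1 / 2) ^ (t * (n - r * t)) * (1 / 4) ^ n)))).trans ?_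
  · refine mul_le_mul_of_nonneg_right ?_ (by positivity)
    have : #(univ.filter fun S : Finset {v // v ∉ Set.range τ} => n ≤ D * #S) ≤ 2 ^ n := by
      refine (card_le_univ _).trans ?_
      rw [Fintype.card_finset, card_compl_range]
      exact Nat.pow_le_pow_right (by norm_num) (by omega)
    exact_mod_cast this
  · have h3 : (Fintype.card (Fin r × Fin t ↪ V) : ℝ) ≤ ((n : ℝ) + 1) ^ (r * t) := by
      have := card_embedding_le (Fin r × Fin t) V
      simp only [Fintype.card_prod, Fintype.card_fin] at this
      calc (Fintype.card (Fin r × Fin t ↪ V) : ℝ) ≤ (n : ℝ) ^ (r * t) := by exact_mod_cast this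
        _ ≤ _ := by gcongr; linarith
    have h4 : (Fintype.card (Option (Fin r × (Fin r → Finset (Fin t)))) : ℝ) =
        r * 2 ^ (r * t) + 1 := by
      simp only [Fintype.card_option, Fintype.card_prod, Fintype.card_fin, Fintype.card_fun,
        Fintype.card_finset]
      push_cast
      rw [← pow_mul, mul_comm t r]
    rw [h4]
    refine (mul_le_mul_of_nonneg_right h3 (by positivity)).trans (le_of_eq ?_)
    have h5 : (2 : ℝ) ^ n * (1 / 4) ^ n = (1 / 2) ^ n := by
      rw [← mul_pow]; norm_num
    rw [← h5]
    ring

/-- The graph joining distinct vertices of the same colour. -/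
def insideGraph {V ι : Type*} (c : V → ι) : SimpleGraph V where
  Adj v w := v ≠ w ∧ c v = c w
  symm := ⟨fun _ _ h => ⟨h.1.symm, h.2.symm⟩⟩
  loopless := ⟨fun _ h => h.1 rfl⟩

/-- The graph joining vertices of different colours. -/
def crossGraph {V ι : Type*} (c : V → ι) : SimpleGraph V :=
  (⊤ : SimpleGraph ι).comap c

theorem insideGraph_adj {V ι : Type*} (c : V → ι) (v w : V) :
    (insideGraph c).Adj v w ↔ v ≠ w ∧ c v = c w := Iff.rfl

theorem crossGraph_adj {V ι : Type*} (c : V → ι) (v w : V) :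
    (crossGraph c).Adj v w ↔ c v ≠ c w := Iff.rfl

/-- The vertices of colour `i`. -/
noncomputable def colourClass {V ι : Type*} [Fintype V] (c : V → ι) (i : ι) : Finset V :=
  univ.filter fun v => c v = i

theorem mem_colourClass {V ι : Type*} [Fintype V] {c : V → ι} {i : ι} {v : V} :
    v ∈ colourClass c i ↔ c v = i := by simp [colourClass]

theorem mem_monoPairs {V ι : Type*} [Fintype V] {G : SimpleGraph V} {c : V → ι} {x : V × V} :
    x ∈ monoPairs G c ↔ G.Adj x.1 x.2 ∧ c x.1 = c x.2 := by simp [monoPairs]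

section Counting

variable {V ι : Type*} [Fintype V] [Fintype ι]

theorem card_sameColour (c : V → ι) :
    #(univ.filter fun x : V × V => c x.1 = c x.2) = ∑ i, #(colourClass c i) ^ 2 := by
  rw [card_eq_sum_card_fiberwise (t := univ) (f := fun x : V × V => c x.1) (fun _ _ => by simp)]
  refine sum_congr rfl fun i _ => ?_
  rw [sq, ← card_product]
  congr 1
  ext ⟨v, w⟩
  simp only [mem_filter, mem_univ, true_and, mem_product, mem_colourClass]
  constructor
  · rintro ⟨h, rfl⟩; exact ⟨rfl, h.symm⟩
  · rintro ⟨rfl, h⟩; exact ⟨h.symm, rfl⟩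

theorem two_mul_card_insideGraph (c : V → ι) :
    2 * #(insideGraph c).edgeFinset + Fintype.card V = ∑ i, #(colourClass c i) ^ 2 := by
  rw [SimpleGraph.two_mul_card_edgeFinset, ← card_sameColour, ← card_univ,
    ← card_image_of_injective (univ : Finset V) (f := fun v => (v, v))
      (fun v w h => (Prod.mk.inj h).1), ← card_union_of_disjoint]
  · congr 1
    ext ⟨v, w⟩
    simp only [mem_union, mem_filter, mem_univ, true_and, mem_image, insideGraph_adj, Prod.mk.injEq]
    by_cases h : v = w
    · subst h; simp
    · simp [h]
  · rw [disjoint_left]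
    rintro ⟨v, w⟩ h h'
    simp only [mem_filter, mem_univ, true_and, mem_image, insideGraph_adj, Prod.mk.injEq] at h h'
    obtain ⟨x, rfl, rfl⟩ := h'
    exact h.1 rfl

theorem two_mul_card_crossGraph (c : V → ι) :
    2 * #(crossGraph c).edgeFinset + ∑ i, #(colourClass c i) ^ 2 =
      Fintype.card V ^ 2 := by
  rw [SimpleGraph.two_mul_card_edgeFinset, ← card_sameColour, sq, ← Fintype.card_prod,
    ← card_univ, add_comm]
  rw [← card_filter_add_card_filter_not (s := (univ : Finset (V × V))) fun x => c x.1 = c x.2]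
  congr 2
  ext ⟨v, w⟩
  simp [crossGraph_adj]

theorem card_crossGraph_add_card_insideGraph (c : V → ι) :
    #(crossGraph c).edgeFinset + #(insideGraph c).edgeFinset = (Fintype.card V).choose 2 := by
  have h1 := two_mul_card_insideGraph c
  have h2 := two_mul_card_crossGraph c
  have h3 := Nat.cast_choose_two ℝ (Fintype.card V)
  have h4 : (2 * #(crossGraph c).edgeFinset + (2 * #(insideGraph c).edgeFinset + Fintype.card V) : ℝ)
    = (Fintype.card V : ℝ) ^ 2 := by exact_mod_cast h1 ▸ h2
  have : (#(crossGraph c).edgeFinset + #(insideGraph c).edgeFinset : ℝ) =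
    ((Fintype.card V).choose 2 : ℝ) := by rw [h3]; linarith
  exact_mod_cast this

theorem sum_card_colour (c : V → ι) : ∑ i, #(colourClass c i) = Fintype.card V := by
  rw [← card_univ]
  exact (card_eq_sum_card_fiberwise (f := c) (t := univ) (s := univ) fun _ _ => mem_univ _).symm

end Counting

section Inside

variable {V : Type*} [Fintype V] {r : ℕ}

theorem sum_sq_sub (hr : 0 < r) (c : V → Fin r) :
    ∑ i, ((#(colourClass c i) : ℝ) - Fintype.card V / r) ^ 2 =
      2 * #(insideGraph c).edgeFinset + Fintype.card V - (Fintype.card V : ℝ) ^ 2 / r := by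
  have h1 : (2 * #(insideGraph c).edgeFinset + Fintype.card V : ℝ) =
      ∑ i, (#(colourClass c i) : ℝ) ^ 2 := by
    exact_mod_cast two_mul_card_insideGraph c
  have h2 : ∑ i, (#(colourClass c i) : ℝ) = Fintype.card V := by
    exact_mod_cast sum_card_colour c
  have hr : (r : ℝ) ≠ 0 := by positivity
  rw [h1]
  simp only [sub_sq, sum_add_distrib, sum_sub_distrib, sum_const, card_univ, Fintype.card_fin,
    nsmul_eq_mul]
  rw [← sum_mul, ← mul_sum, h2]
  field_simp
  ring

theorem le_card_insideGraph (hr : 0 < r) (c : V → Fin r) :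
    (Fintype.card V : ℝ) ^ 2 / (2 * r) - Fintype.card V / 2 ≤ #(insideGraph c).edgeFinset := by
  have h := sum_sq_sub hr c
  have h0 : 0 ≤ ∑ i, ((#(colourClass c i) : ℝ) - Fintype.card V / r) ^ 2 :=
    sum_nonneg fun _ _ => sq_nonneg _
  have : (Fintype.card V : ℝ) ^ 2 / (2 * r) = (Fintype.card V : ℝ) ^ 2 / r / 2 := by
    rw [div_div, mul_comm]
  linarith

theorem le_card_insideGraph_of_small (hr : 0 < r) (c : V → Fin r) (i : Fin r)
    (hi : 2 * r * #(colourClass c i) ≤ Fintype.card V) :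
    (Fintype.card V : ℝ) ^ 2 / (2 * r) + (Fintype.card V : ℝ) ^ 2 / (8 * r ^ 2) -
      Fintype.card V / 2 ≤ #(insideGraph c).edgeFinset := by
  have h := sum_sq_sub hr c
  have h0 := single_le_sum (f := fun i => ((#(colourClass c i) : ℝ) -
    Fintype.card V / r) ^ 2) (fun _ _ => sq_nonneg _) (mem_univ i)
  have hr' : (0 : ℝ) < r := by exact_mod_cast hr
  have h1 : (#(colourClass c i) : ℝ) ≤ Fintype.card V / (2 * r) := by
    rw [le_div_iff₀ (by positivity), mul_comm]
    exact_mod_cast hi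
  have h2 : (Fintype.card V / (2 * r) : ℝ) ^ 2 ≤
      ((#(colourClass c i) : ℝ) - Fintype.card V / r) ^ 2 := by
    rw [sq_le_sq, abs_of_nonneg (by positivity), abs_sub_comm]
    refine le_trans ?_ (le_abs_self _)
    have : (Fintype.card V / r : ℝ) = 2 * (Fintype.card V / (2 * r)) := by field_simp
    linarith
  have e1 : (Fintype.card V : ℝ) ^ 2 / (2 * r) = (Fintype.card V : ℝ) ^ 2 / r / 2 := by
    rw [div_div, mul_comm]
  have e2 : (Fintype.card V : ℝ) ^ 2 / (8 * r ^ 2) = (Fintype.card V / (2 * r) : ℝ) ^ 2 / 2 := by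
    field_simp; norm_num
  rw [e1, e2]
  linarith

theorem edge_of_monoPairs_eq {c : V → Fin r} {G G' : SimpleGraph V}
    (h : monoPairs G c = monoPairs G' c) :
    ∀ e ∈ (insideGraph c).edgeFinset, e ∈ G.edgeSet → e ∈ G'.edgeSet := by
  intro e he heG
  induction e with
  | h a b =>
    simp only [SimpleGraph.mem_edgeFinset, SimpleGraph.mem_edgeSet, insideGraph_adj] at he heG ⊢
    have : (a, b) ∈ monoPairs G' c := by
      rw [← h]; exact mem_monoPairs.2 ⟨heG, he.2⟩
    exact (mem_monoPairs.1 this).1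

theorem not_isDiag_of_mem_edgeFinset {H : SimpleGraph V} {e : Sym2 V} (he : e ∈ H.edgeFinset) :
    ¬ e.IsDiag :=
  H.not_isDiag_of_mem_edgeSet (SimpleGraph.mem_edgeFinset.1 he)

theorem gdens_monoPairs_le (c : V → Fin r) (h N : ℕ) :
    gdens (fun G : SimpleGraph V => h * #(monoPairs G c) ≤ N) ≤
      #(univ.filter fun P : Finset (V × V) => h * #P ≤ N) / 2 ^ #(insideGraph c).edgeFinset := by
  have key := gdens_le_prod_blocks (ι := Empty) (α := Unit)
    (fun G : SimpleGraph V => h * #(monoPairs G c) ≤ N)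
    (insideGraph c).edgeFinset (fun _ => ∅) (fun _ => not_isDiag_of_mem_edgeFinset) (by simp)
    (by simp) (by simp) (fun G => monoPairs G c)
    (univ.filter fun P : Finset (V × V) => h * #P ≤ N) (fun _ _ => ()) (fun _ => univ)
    (fun G hG => by simpa using hG) (by simp) (fun G G' _ _ hGG => edge_of_monoPairs_eq hGG)
    (by simp)
  simpa using key

/-- A complete multipartite subgraph of an `r`-partite graph contains a transversal one. -/
theorem HasMultipartite.exists_transversal {ι : Type*} {W : Type*} [Fintype ι] {s : ℕ} (hs : 0 < s)
    (c : W → ι) {G : SimpleGraph W} (hG : G ≤ crossGraph c) (hι : 0 < Fintype.card ι)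
    (h : HasMultipartite (Fintype.card ι) (Fintype.card ι * s) G) :
    ∃ T : ι → Finset W, (∀ i, ∀ x ∈ T i, c x = i) ∧ (∀ i, s ≤ #(T i)) ∧ IsCompleteBetween G T := by
  obtain ⟨τ, hτ⟩ := h
  have hp : ∀ p, ∃ i, s ≤ #(univ.filter fun b => c (τ (p, b)) = i) := by
    intro p
    have := Fintype.card_pos_iff.1 hι
    obtain ⟨i, -, hi⟩ := exists_le_card_fiber_of_mul_le_card_of_maps_to (s := univ) (t := univ)
      (f := fun b => c (τ (p, b))) (n := s) (fun _ _ => mem_univ _) univ_nonempty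
      (by simp)
    exact ⟨i, hi⟩
  choose g hg using hp
  have hinj : Function.Injective g := by
    intro p p' hpp
    by_contra hne
    obtain ⟨b, hb⟩ := card_pos.1 (hs.trans_le (hg p))
    obtain ⟨b', hb'⟩ := card_pos.1 (hs.trans_le (hg p'))
    rw [mem_filter] at hb hb'
    exact hG (hτ (p, b) (p', b') hne) (by
      rw [hb.2, hb'.2, hpp])
  have hsurj : Function.Surjective g :=
    ((Fintype.bijective_iff_injective_and_card g).2 ⟨hinj, by simp⟩).2
  choose f hf using hsurj
  refine ⟨fun i => (univ.filter fun b => c (τ (f i, b)) = i).image fun b => τ (f i, b), ?_, ?_, ?_⟩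
  · intro i x hx
    obtain ⟨b, hb, rfl⟩ := mem_image.1 hx
    exact (mem_filter.1 hb).2
  · intro i
    rw [card_image_of_injective _ fun a b hab => by simpa using τ.injective hab]
    have := hg (f i)
    rwa [hf] at this
  · intro i j hij a ha b hb
    obtain ⟨a, -, rfl⟩ := mem_image.1 ha
    obtain ⟨b, -, rfl⟩ := mem_image.1 hb
    refine hτ _ _ fun h => hij ?_
    rw [← hf i, ← hf j]; exact congrArg g h

end Inside

theorem gdens_no_transversal_le {V : Type*} [Fintype V] {r a s : ℕ} (hr : 0 < r) (hs : 0 < s)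
    (c : V → Fin r) (φ : Fin r × Fin a ↪ V) (hφ : ∀ x, c (φ x) = x.1) (h N : ℕ) :
    gdens (fun G : SimpleGraph V => h * #(monoPairs G c) ≤ N ∧
        ∀ T : Fin r → Finset V, (∀ i, ∀ v ∈ T i, ∃ b, φ (i, b) = v) → (∀ i, s ≤ #(T i)) →
          ¬ IsCompleteBetween G T) ≤
      #(univ.filter fun P : Finset (V × V) => h * #P ≤ N) / 2 ^ #(insideGraph c).edgeFinset *
        (gdens (fun G : SimpleGraph (Fin r × Fin a) => ¬ HasMultipartite r (r * s) G) *
          2 ^ #(insideGraph (Prod.fst : Fin r × Fin a → Fin r)).edgeFinset) := by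
  set C := crossGraph (Prod.fst : Fin r × Fin a → Fin r) with hC
  set Q := fun G : SimpleGraph V => h * #(monoPairs G c) ≤ N ∧
        ∀ T : Fin r → Finset V, (∀ i, ∀ v ∈ T i, ∃ b, φ (i, b) = v) → (∀ i, s ≤ #(T i)) →
          ¬ IsCompleteBetween G T with hQ
  have key := gdens_le_prod_blocks (ι := Unit) Q
    (insideGraph c).edgeFinset (fun _ => C.edgeFinset.image (Sym2.map φ))
    (fun _ => not_isDiag_of_mem_edgeFinset) ?_ ?_ ?_ (fun G => monoPairs G c)
    (univ.filter fun P : Finset (V × V) => h * #P ≤ N) (fun _ G => G.comap φ ⊓ C)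
    (fun _ => univ.filter fun H => ¬ HasMultipartite r (r * s) H)
    (fun G hG => by simpa using hG.1) ?_ (fun G G' _ _ hGG => edge_of_monoPairs_eq hGG) ?_
  · refine key.trans (mul_le_mul_of_nonneg_left (le_of_eq ?_) (by positivity))
    have h1 := card_crossGraph_add_card_insideGraph (Prod.fst : Fin r × Fin a → Fin r)
    rw [← hC] at h1
    rw [Fintype.prod_unique, card_image_of_injective _ (Sym2.map.injective φ.injective)]
    unfold gdens
    rw [← h1, pow_add, div_mul_eq_mul_div, mul_div_mul_right _ _ (by positivity)]
    congr 2
    rw [← Set.ncard_coe_finset]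
    congr 1
    ext G
    simp
  · intro _ e he
    obtain ⟨e, he₂, rfl⟩ := mem_image.1 he
    rw [Sym2.isDiag_map φ.injective]
    exact not_isDiag_of_mem_edgeFinset he₂
  · intro _
    rw [disjoint_left]
    intro e he he'
    obtain ⟨e, he₂, rfl⟩ := mem_image.1 he'
    induction e with
    | h x y =>
      rw [SimpleGraph.mem_edgeFinset, SimpleGraph.mem_edgeSet, hC, crossGraph_adj] at he₂
      rw [SimpleGraph.mem_edgeFinset, Sym2.map_mk, SimpleGraph.mem_edgeSet, insideGraph_adj] at he
      have := he.2
      simp only [hφ] at this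
      exact he₂ this
  · intro i j hij
    exact absurd (Subsingleton.elim i j) hij
  · intro G hG _
    rw [mem_filter]
    refine ⟨mem_univ _, fun hM => ?_⟩
    have hM' : HasMultipartite (Fintype.card (Fin r)) (Fintype.card (Fin r) * s)
        (G.comap φ ⊓ C) := by rwa [Fintype.card_fin]
    obtain ⟨T, hT, hTs, hTc⟩ := hM'.exists_transversal hs Prod.fst inf_le_right (by simpa using hr)
    refine hG.2 (fun i => (T i).map φ) ?_ (by simpa using hTs) ?_
    · intro i v hv
      obtain ⟨x, hx, rfl⟩ := mem_map.1 hv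
      have := hT i x hx
      subst this
      exact ⟨x.2, rfl⟩
    · intro i j hij a ha b hb
      obtain ⟨a, ha₂, rfl⟩ := mem_map.1 ha
      obtain ⟨b, hb₂, rfl⟩ := mem_map.1 hb
      exact (hTc i j hij a ha₂ b hb₂).1
  · intro G G' _ _ _ hGG e he heG
    obtain ⟨e, he₂, rfl⟩ := mem_image.1 he
    induction e with
    | h x y =>
      rw [SimpleGraph.mem_edgeFinset, SimpleGraph.mem_edgeSet] at he₂
      have h1 : (G.comap φ ⊓ C).Adj x y := ⟨by simpa using heG, he₂⟩
      have hGG : G.comap φ ⊓ C = G'.comap φ ⊓ C := hGG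
      rw [hGG] at h1
      simpa using h1.1

/-- Every colour has a set of at least `n/h` vertices such that no complete multipartite graph
with parts of size `s` is transversal to these sets. -/
def HasHole {V : Type*} [Fintype V] {r : ℕ} (s h : ℕ) (c : V → Fin r) (G : SimpleGraph V) : Prop :=
  ∃ A : Fin r → Finset V, (∀ i, ∀ v ∈ A i, c v = i) ∧ (∀ i, Fintype.card V ≤ h * #(A i)) ∧
    ∀ T : Fin r → Finset V, (∀ i, T i ⊆ A i) → (∀ i, s ≤ #(T i)) → ¬ IsCompleteBetween G T

theorem gdens_hasHole_le (r s h : ℕ) (hr : 2 ≤ r) (hs : 0 < s) (hh : 0 < h) :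
    ∃ C : ℝ, 0 < C ∧ ∀ (V : Type) [Fintype V] (c : V → Fin r) (H : ℕ),
      gdens (fun G : SimpleGraph V => H * #(monoPairs G c) ≤ Fintype.card V ^ 2 ∧
          HasHole s h c G) ≤
        2 ^ (r * Fintype.card V) * (C *
          (#(univ.filter fun P : Finset (V × V) => H * #P ≤ Fintype.card V ^ 2) /
            2 ^ #(insideGraph c).edgeFinset) *
              2 ^ (-((Fintype.card V : ℝ) ^ 2 / (4 * h ^ 2)))) := by
  obtain ⟨k, rfl⟩ : ∃ k, r = k + 1 := ⟨r - 1, by omega⟩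
  have hk : (1 : ℝ) ≤ k := by exact_mod_cast (by omega : 1 ≤ k)
  set β : ℝ := (2 * k + 1) / (4 * (k + 1) * k) with hβ
  obtain ⟨C, hC, hP⟩ := gdens_not_hasMultipartite_le k ((k + 1) * s) β (by positivity) (by
    rw [hβ, mul_div_assoc', div_lt_one (by positivity)]; nlinarith)
  refine ⟨C, hC, fun V _ c H => ?_⟩
  set n := Fintype.card V with hn
  set a := (n + h - 1) / h with ha
  have ha1 : n ≤ h * a := by
    have := Nat.lt_div_mul_add hh (a := n + h - 1)
    rw [← ha, mul_comm] at this
    omega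
  have ha2 : ∀ m, n ≤ h * m → a ≤ m := by
    intro m hm
    rw [ha, Nat.div_le_iff_le_mul_add_pred hh]
    omega
  refine (gdens_mono (R := fun G => ∃ A : Fin (k + 1) → Finset V,
    H * #(monoPairs G c) ≤ n ^ 2 ∧ (∀ i, ∀ v ∈ A i, c v = i) ∧ (∀ i, n ≤ h * #(A i)) ∧
    ∀ T : Fin (k + 1) → Finset V, (∀ i, T i ⊆ A i) → (∀ i, s ≤ #(T i)) →
      ¬ IsCompleteBetween G T) fun G ⟨h1, A, hA⟩ => ⟨A, h1, hA⟩).trans ?_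
  have hcard : (Fintype.card (Fin (k + 1) → Finset V) : ℝ) = 2 ^ ((k + 1) * n) := by
    rw [Fintype.card_fun, Fintype.card_finset, Fintype.card_fin, ← pow_mul, mul_comm]
    push_cast; rfl
  rw [← hcard]
  refine gdens_exists_le _ fun A => ?_
  by_cases hA : (∀ i, ∀ v ∈ A i, c v = i) ∧ ∀ i, n ≤ h * #(A i)
  swap
  · refine (gdens_mono (R := fun _ => False) fun G hG => hA ⟨hG.2.1, hG.2.2.1⟩).trans ?_
    rw [gdens_false]
    positivity
  obtain ⟨hA1, hA2⟩ := hA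
  have he : ∀ i, ∃ f : Fin a ↪ V, ∀ b, f b ∈ A i := by
    intro i
    obtain ⟨f⟩ : Nonempty (Fin a ↪ A i) :=
      Function.Embedding.nonempty_of_card_le (by simpa using ha2 _ (hA2 i))
    exact ⟨f.trans (Function.Embedding.subtype _), fun b => (f b).2⟩
  choose f hf using he
  let φ : Fin (k + 1) × Fin a ↪ V := ⟨fun x => f x.1 x.2, by
    rintro ⟨i, x⟩ ⟨j, y⟩ hxy
    have hxy : f i x = f j y := hxy
    have hij : i = j := by rw [← hA1 i _ (hf i x), hxy, hA1 j _ (hf j y)]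
    subst hij
    simpa using hxy⟩
  have hφ : ∀ x, c (φ x) = x.1 := fun x => hA1 _ _ (hf x.1 x.2)
  refine (gdens_mono fun G hG => ⟨hG.1, fun T hT hTs => hG.2.2.2 T ?_ hTs⟩).trans
    ((gdens_no_transversal_le (by omega) hs c φ hφ H (n ^ 2)).trans ?_)
  swap
  · intro i v hv
    obtain ⟨b, rfl⟩ := hT i v hv
    exact hf i b
  rw [mul_comm C, mul_assoc]
  refine mul_le_mul_of_nonneg_left ?_ (by positivity)
  refine (mul_le_mul_of_nonneg_right (hP _) (by positivity)).trans ?_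
  rw [mul_assoc]
  refine mul_le_mul_of_nonneg_left ?_ hC.le
  have h1 : (2 * #(insideGraph (Prod.fst : Fin (k + 1) × Fin a → Fin (k + 1))).edgeFinset +
      (k + 1) * a : ℝ) = (k + 1) * a ^ 2 := by
    have h2 := two_mul_card_insideGraph (Prod.fst : Fin (k + 1) × Fin a → Fin (k + 1))
    have h3 : ∀ i, #(colourClass (Prod.fst : Fin (k + 1) × Fin a → Fin (k + 1)) i) = a := by
      intro i
      have : colourClass (Prod.fst : Fin (k + 1) × Fin a → Fin (k + 1)) i = {i} ×ˢ univ := by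
        ext ⟨x, y⟩
        simp [mem_colourClass, eq_comm]
      rw [this, card_product]; simp
    simp only [h3, Fintype.card_prod, Fintype.card_fin, sum_const, card_univ, smul_eq_mul] at h2
    exact_mod_cast h2
  rw [← Real.rpow_natCast 2 #(insideGraph (Prod.fst : Fin (k + 1) × Fin a → Fin (k + 1))).edgeFinset,
    ← Real.rpow_add (by norm_num)]
  refine Real.rpow_le_rpow_of_exponent_le (by norm_num) ?_
  have h3 : ((Fintype.card (Fin (k + 1) × Fin a) : ℕ) : ℝ) = (k + 1) * a := by
    simp
  rw [h3]
  have h4 : (n : ℝ) ^ 2 / (4 * h ^ 2) ≤ (a : ℝ) ^ 2 / 4 := by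
    have : (n : ℝ) ≤ h * a := by exact_mod_cast ha1
    have hh' : (0 : ℝ) < h := by exact_mod_cast hh
    rw [div_le_div_iff₀ (by positivity) (by norm_num)]
    have : (n : ℝ) ^ 2 ≤ (h * a) ^ 2 := by gcongr
    nlinarith
  have h5 : β * ((k + 1) * a) ^ 2 = ((k : ℝ) + 1) * a ^ 2 / 2 + (k + 1) / (4 * k) * a ^ 2 := by
    rw [hβ]; field_simp; ring
  have h6 : (1 : ℝ) / 4 ≤ (k + 1) / (4 * k) := by
    rw [div_le_div_iff₀ (by norm_num) (by positivity)]; linarith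
  have h7 := mul_le_mul_of_nonneg_right h6 (sq_nonneg (a : ℝ))
  have h8 : (0 : ℝ) ≤ (k + 1) * a := by positivity
  linarith

/-- The neighbours of `v` of colour `j`. -/
noncomputable def nbrIn {V ι : Type*} [Fintype V] (G : SimpleGraph V) (c : V → ι) (v : V) (j : ι) :
    Finset V :=
  univ.filter fun w => G.Adj v w ∧ c w = j

theorem mem_nbrIn {V ι : Type*} [Fintype V] {G : SimpleGraph V} {c : V → ι} {v w : V} {j : ι} :
    w ∈ nbrIn G c v j ↔ G.Adj v w ∧ c w = j := by simp [nbrIn]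

/-- `c` minimises the number of monochromatic edges of `G`. -/
def IsMinColouring {V ι : Type*} [Fintype V] (G : SimpleGraph V) (c : V → ι) : Prop :=
  ∀ c' : V → ι, #(monoPairs G c) ≤ #(monoPairs G c')

section Deterministic

variable {V : Type*} [Fintype V] {r : ℕ} {G : SimpleGraph V} {c : V → Fin r}

theorem card_monoPairs_eq {ι : Type*} (G : SimpleGraph V) (c : V → ι) (v : V) :
    #(monoPairs G c) = #((monoPairs G c).filter fun x => x.1 ≠ v ∧ x.2 ≠ v) +
      2 * #(nbrIn G c v (c v)) := by
  rw [← card_filter_add_card_filter_not (s := monoPairs G c) fun x => x.1 ≠ v ∧ x.2 ≠ v]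
  congr 1
  have h1 : (monoPairs G c).filter (fun x => ¬ (x.1 ≠ v ∧ x.2 ≠ v)) =
      (nbrIn G c v (c v)).image (fun w => (v, w)) ∪ (nbrIn G c v (c v)).image fun w => (w, v) := by
    ext ⟨a, b⟩
    simp only [mem_filter, mem_monoPairs, mem_union, mem_image, mem_nbrIn, Prod.mk.injEq]
    constructor
    · rintro ⟨⟨h1, h2⟩, h3⟩
      by_cases hb : b = v
      · exact Or.inr ⟨a, ⟨hb ▸ h1.symm, hb ▸ h2⟩, rfl, hb.symm⟩
      · have ha : a = v := by tauto
        exact Or.inl ⟨b, ⟨ha ▸ h1, by rw [← h2, ha]⟩, ha.symm, rfl⟩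
    · rintro (⟨w, ⟨h1, h2⟩, rfl, rfl⟩ | ⟨w, ⟨h1, h2⟩, rfl, rfl⟩)
      · exact ⟨⟨h1, h2.symm⟩, by simp⟩
      · exact ⟨⟨h1.symm, h2⟩, by simp⟩
  rw [h1, card_union_of_disjoint, card_image_of_injective _ (Prod.mk_right_injective v),
    card_image_of_injective _ (Prod.mk_left_injective v), two_mul]
  rw [disjoint_left]
  intro p hp hp'
  obtain ⟨w, hw, rfl⟩ := mem_image.1 hp
  obtain ⟨w', hw', h⟩ := mem_image.1 hp'
  rw [Prod.mk.injEq] at h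
  rw [h.1, mem_nbrIn] at hw'
  exact hw'.1.ne rfl

theorem IsMinColouring.card_nbrIn_le (hc : IsMinColouring G c) (v : V) (j : Fin r) :
    #(nbrIn G c v (c v)) ≤ #(nbrIn G c v j) := by
  have h1 := hc (Function.update c v j)
  rw [card_monoPairs_eq G c v, card_monoPairs_eq G _ v] at h1
  have h2 : (monoPairs G (Function.update c v j)).filter (fun x => x.1 ≠ v ∧ x.2 ≠ v) =
      (monoPairs G c).filter fun x => x.1 ≠ v ∧ x.2 ≠ v := by
    ext x
    simp only [mem_filter, mem_monoPairs]
    refine and_congr_left fun h => ?_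
    rw [Function.update_of_ne h.1, Function.update_of_ne h.2]
  have h3 : nbrIn G (Function.update c v j) v (Function.update c v j v) = nbrIn G c v j := by
    ext w
    rw [mem_nbrIn, mem_nbrIn, Function.update_self]
    refine and_congr_right fun h => ?_
    rw [Function.update_of_ne h.ne']
  rw [h2, h3] at h1
  omega

theorem HasPlus.of_pair {V : Type*} {r s : ℕ} {G : SimpleGraph V} {T : Fin r → Finset V} (hT : ∀ i, s ≤ #(T i))
    (hc : IsCompleteBetween G T) (i : Fin r) {a b : V} (hab : G.Adj a b)
    (ha : ∀ j, j ≠ i → ∀ v ∈ T j, G.Adj a v) (hb : ∀ j, j ≠ i → ∀ v ∈ T j, G.Adj b v) :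
    HasPlus r s G := by
  refine ⟨Function.update T i (insert a (insert b (T i))), ?_, ?_, i, a, by simp, b, by simp, hab⟩
  · intro j
    by_cases hj : j = i
    · subst hj
      rw [Function.update_self]
      exact (hT j).trans (card_le_card fun v hv => by simp [hv])
    · rw [Function.update_of_ne hj]
      exact hT j
  · have key : ∀ j, j ≠ i → ∀ u ∈ insert a (insert b (T i)), ∀ v ∈ T j, G.Adj u v := by
      intro j hj u hu v hv
      rw [mem_insert, mem_insert] at hu
      rcases hu with rfl | rfl | hu
      · exact ha j hj v hv
      · exact hb j hj v hv
      · exact hc i j hj.symm u hu v hv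
    intro j k hjk u hu v hv
    by_cases hj : j = i
    · subst hj
      rw [Function.update_self] at hu
      rw [Function.update_of_ne hjk.symm] at hv
      exact key k hjk.symm u hu v hv
    · rw [Function.update_of_ne hj] at hu
      by_cases hk : k = i
      · subst hk
        rw [Function.update_self] at hv
        exact (key j hj v hv u hu).symm
      · rw [Function.update_of_ne hk] at hv
        exact hc j k hjk u hu v hv

theorem IsMinColouring.mul_card_nbrIn_lt {s h : ℕ} (hs : 0 < s) (hc : IsMinColouring G c)
    (hP : ¬ HasPlus r s G) (hH : ¬ HasHole s h c G) (v : V) :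
    h * #(nbrIn G c v (c v)) < Fintype.card V := by
  by_contra! hlt
  refine hH ⟨nbrIn G c v, fun i w hw => (mem_nbrIn.1 hw).2,
    fun i => hlt.trans (Nat.mul_le_mul_left _ (hc.card_nbrIn_le v i)), fun T hT hTs hTc => hP ?_⟩
  obtain ⟨b, hb⟩ := card_pos.1 (hs.trans_le (hTs (c v)))
  exact HasPlus.of_pair hTs hTc (c v) (mem_nbrIn.1 (hT _ hb)).1
    (fun j _ w hw => (mem_nbrIn.1 (hT _ hw)).1) fun j hj w hw => hTc _ _ hj.symm b hb w hw

theorem exists_small_common_nbr {s h : ℕ} (hh : 4 * r ≤ h)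
    (hn : 8 * r ≤ Fintype.card V)
    (hP : ¬ HasPlus r s G) (hH : ¬ HasHole s h c G)
    (hbig : ∀ i, Fintype.card V < 2 * r * #(colourClass c i)) {x y : V} (hxy : G.Adj x y) :
    ∃ j, j ≠ c x ∧ h * #(nbrIn G c x j ∩ nbrIn G c y j) < Fintype.card V := by
  by_contra! hlt
  refine hH ⟨fun j => if j = c x then colourClass c j \ {x, y} else nbrIn G c x j ∩ nbrIn G c y j,
    fun i v hv => ?_, fun i => ?_, fun T hT hTs hTc => hP ?_⟩
  · dsimp only at hv
    split_ifs at hv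
    · exact mem_colourClass.1 (mem_sdiff.1 hv).1
    · exact (mem_nbrIn.1 (mem_inter.1 hv).1).2
  · dsimp only
    split_ifs with hi
    · have h1 := le_card_sdiff {x, y} (colourClass c i)
      have h2 : #({x, y} : Finset V) ≤ 2 := card_le_two
      have h3 := hbig i
      have h4 : #(colourClass c i) ≤ #(colourClass c i \ {x, y}) + 2 := by omega
      have h5 := Nat.mul_le_mul_right #(colourClass c i \ {x, y}) hh
      have h6 := Nat.mul_le_mul_left (2 * r) h4
      nlinarith
    · exact hlt i hi
  · refine HasPlus.of_pair hTs hTc (c x) hxy (fun j hj v hv => ?_) fun j hj v hv => ?_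
    · have := hT j hv
      simp only [if_neg hj, mem_inter, mem_nbrIn] at this
      exact this.1.1
    · have := hT j hv
      simp only [if_neg hj, mem_inter, mem_nbrIn] at this
      exact this.2.1

/-- The end vertices `x₁, …, x_k` and `y₁, …, y_k` of a matching of monochromatic edges. -/
def IsInsideMatching {ι : Type*} (G : SimpleGraph V) (c : V → ι) {k : ℕ}
    (f : Fin k ⊕ Fin k → V) : Prop :=
  Function.Injective f ∧ ∀ a, G.Adj (f (Sum.inl a)) (f (Sum.inr a)) ∧
    c (f (Sum.inl a)) = c (f (Sum.inr a))

theorem exists_insideMatching {ι : Type*} (G : SimpleGraph V) (c : V → ι) (m : ℕ) :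
    ∃ k ≤ m, ∃ f : Fin k ⊕ Fin k → V, IsInsideMatching G c f ∧
      (k = m ∨ ∀ x y, G.Adj x y → c x = c y → (∃ a, f a = x) ∨ ∃ a, f a = y) := by
  set P : ℕ → Prop := fun k => ∃ f : Fin k ⊕ Fin k → V, IsInsideMatching G c f with hPdef
  have hP0 : P 0 := ⟨fun x => x.elim Fin.elim0 Fin.elim0, fun x => x.elim Fin.elim0 Fin.elim0,
    fun a => a.elim0⟩
  obtain ⟨f, hf⟩ := Nat.findGreatest_spec (P := P) (Nat.zero_le m) hP0
  refine ⟨Nat.findGreatest P m, Nat.findGreatest_le m, f, hf, ?_⟩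
  rcases (Nat.findGreatest_le (P := P) m).lt_or_eq with hlt | heq
  · right
    by_contra! hxy
    obtain ⟨x, y, hadj, hc, hx, hy⟩ := hxy
    refine Nat.findGreatest_is_greatest (Nat.lt_succ_self _) hlt ?_
    refine ⟨Sum.elim (Fin.snoc (fun a => f (Sum.inl a)) x) (Fin.snoc (fun a => f (Sum.inr a)) y),
      ?_, fun a => ?_⟩
    · rw [Sum.elim_injective]
      refine ⟨?_, ?_, ?_⟩
      · rw [Fin.snoc_injective_iff]
        exact ⟨hf.1.comp Sum.inl_injective, fun ⟨a, ha⟩ => hx _ ha⟩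
      · rw [Fin.snoc_injective_iff]
        exact ⟨hf.1.comp Sum.inr_injective, fun ⟨a, ha⟩ => hy _ ha⟩
      · intro a b
        refine Fin.lastCases ?_ (fun a => ?_) a <;> refine Fin.lastCases ?_ (fun b => ?_) b
        · simpa using hadj.ne
        · simpa using (hx _).symm
        · simpa using hy _
        · simpa using fun h => by simpa using hf.1 h
    · refine Fin.lastCases ?_ (fun a => ?_) a
      · simpa using ⟨hadj, hc⟩
      · simpa using hf.2 a
  · exact Or.inl heq

end Deterministic

theorem gdens_matching_le {V κ : Type*} [Fintype V] {r k : ℕ} (c : V → Fin r)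
    (f : Fin k ⊕ Fin k → V) (hf : Function.Injective f)
    (hc : ∀ a, c (f (Sum.inl a)) = c (f (Sum.inr a))) (j : Fin k → Fin r)
    (hj : ∀ a, j a ≠ c (f (Sum.inl a))) (h n : ℕ) (hh : 0 < h) (Q : SimpleGraph V → Prop)
    (hQ : ∀ G, Q G → ∀ a,
      h * #(nbrIn G c (f (Sum.inl a)) (j a) ∩ nbrIn G c (f (Sum.inr a)) (j a)) < n)
    (σ : SimpleGraph V → κ) (S : Finset κ) (hσ : ∀ G, Q G → σ G ∈ S)
    (hσe : ∀ G G', Q G → Q G' → σ G = σ G' →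
      ∀ e ∈ (insideGraph c).edgeFinset, e ∈ G.edgeSet → e ∈ G'.edgeSet) :
    gdens Q ≤ #S / 2 ^ #(insideGraph c).edgeFinset *
      ∏ a, (2 ^ ((n : ℝ) / h) * (7 / 8) ^ #(colourClass c (j a) \ univ.image f)) := by
  set Z : Fin k → Finset V := fun a => colourClass c (j a) \ univ.image f with hZ
  have hZc : ∀ a, ∀ z ∈ Z a, c z = j a := fun a z hz => mem_colourClass.1 (mem_sdiff.1 hz).1
  have hZf : ∀ a, ∀ z ∈ Z a, ∀ u, f u ≠ z := fun a z hz u hu =>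
    (mem_sdiff.1 hz).2 (mem_image.2 ⟨u, mem_univ _, hu⟩)
  set b : Fin k → Finset (Sym2 V) := fun a =>
    (({Sum.inl a, Sum.inr a} : Finset (Fin k ⊕ Fin k)) ×ˢ Z a).image fun p => s(f p.1, p.2) with hb
  have hmem : ∀ a e, e ∈ b a → ∃ u, (u = Sum.inl a ∨ u = Sum.inr a) ∧ ∃ z ∈ Z a,
      e = s(f u, z) := by
    intro a e he
    obtain ⟨⟨u, z⟩, hp, rfl⟩ := mem_image.1 he
    rw [mem_product] at hp
    exact ⟨u, by simpa using hp.1, z, hp.2, rfl⟩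
  have hcne : ∀ a u, (u = Sum.inl a ∨ u = Sum.inr a) → ∀ z ∈ Z a, c (f u) ≠ c z := by
    rintro a u (rfl | rfl) z hz heq
    · exact hj a (by rw [heq, hZc a z hz])
    · exact hj a (by rw [hc, heq, hZc a z hz])
  have hsym : ∀ a a' u u', ∀ z ∈ Z a, ∀ z' ∈ Z a', s(f u, z) = s(f u', z') → u = u' ∧ z = z' := by
    intro a a' u u' z hz z' hz' heq
    rcases Sym2.eq_iff.1 heq with ⟨h1, h2⟩ | ⟨h1, -⟩
    · exact ⟨hf h1, h2⟩
    · exact absurd h1 (hZf a' z' hz' u)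
  have hbcard : ∀ a, #(b a) = 2 * #(Z a) := by
    intro a
    rw [hb, card_image_of_injOn, card_product, card_pair (by simp)]
    rintro ⟨u, z⟩ hp ⟨u', z'⟩ hp' heq
    rw [mem_coe, mem_product] at hp hp'
    obtain ⟨h1, h2⟩ := hsym a a u u' z hp.2 z' hp'.2 heq
    rw [h1, h2]
  refine (gdens_le_prod_blocks Q (insideGraph c).edgeFinset b
    (fun _ => not_isDiag_of_mem_edgeFinset) ?_ ?_ ?_ σ S
    (fun a G => (nbrIn G c (f (Sum.inl a)) (j a) ∩ Z a, nbrIn G c (f (Sum.inr a)) (j a) ∩ Z a))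
    (fun a => ((Z a).powerset ×ˢ (Z a).powerset).filter fun x => h * #(x.1 ∩ x.2) < n)
    hσ ?_ hσe ?_).trans ?_
  · intro a e he
    obtain ⟨u, hu, z, hz, rfl⟩ := hmem a e he
    rw [Sym2.mk_isDiag_iff]
    exact fun heq => hcne a u hu z hz (by rw [heq])
  · intro a
    rw [disjoint_left]
    intro e he he'
    obtain ⟨u, hu, z, hz, rfl⟩ := hmem a e he'
    rw [SimpleGraph.mem_edgeFinset, SimpleGraph.mem_edgeSet, insideGraph_adj] at he
    exact hcne a u hu z hz he.2
  · intro a a' haa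
    rw [disjoint_left]
    intro e he he'
    obtain ⟨u, hu, z, hz, hez⟩ := hmem a e he
    obtain ⟨u', hu', z', hz', hez'⟩ := hmem a' e he'
    obtain ⟨rfl, -⟩ := hsym a a' u u' z hz z' hz' (hez ▸ hez')
    rcases hu with rfl | rfl <;> rcases hu' with hu' | hu' <;> simp [haa] at hu'
  · intro G hG a
    rw [mem_filter, mem_product, mem_powerset, mem_powerset]
    refine ⟨⟨inter_subset_right, inter_subset_right⟩, lt_of_le_of_lt ?_ (hQ G hG a)⟩
    exact Nat.mul_le_mul_left _ (card_le_card
      (inter_subset_inter inter_subset_left inter_subset_left))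
  · intro G G' _ _ a hGG e he heG
    obtain ⟨u, hu, z, hz, rfl⟩ := hmem a e he
    rw [SimpleGraph.mem_edgeSet] at heG ⊢
    rw [Prod.mk.injEq] at hGG
    have key : ∀ v, nbrIn G c v (j a) ∩ Z a = nbrIn G' c v (j a) ∩ Z a → G.Adj v z → G'.Adj v z := by
      intro v hv hG
      have : z ∈ nbrIn G c v (j a) ∩ Z a := mem_inter.2 ⟨mem_nbrIn.2 ⟨hG, hZc a z hz⟩, hz⟩
      rw [hv] at this
      exact (mem_nbrIn.1 (mem_inter.1 this).1).1
    rcases hu with rfl | rfl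
    · exact key _ hGG.1 heG
    · exact key _ hGG.2 heG
  · refine mul_le_mul_of_nonneg_left (prod_le_prod (fun a _ => by positivity) fun a _ => ?_)
      (by positivity)
    rw [hbcard, div_le_iff₀ (by positivity), mul_assoc, pow_mul, ← mul_pow]
    exact (card_pairs_small_inter_le (Z a) h n hh).trans (by norm_num [hZ])

theorem edge_of_cover {V : Type*} [Fintype V] {ι κ : Type*} {c : V → ι} {G G' : SimpleGraph V}
    {f : κ → V} (hG : ∀ x y, G.Adj x y → c x = c y → (∃ a, f a = x) ∨ ∃ a, f a = y)
    (hGG : ∀ u, nbrIn G c (f u) (c (f u)) = nbrIn G' c (f u) (c (f u))) :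
    ∀ e ∈ (insideGraph c).edgeFinset, e ∈ G.edgeSet → e ∈ G'.edgeSet := by
  intro e he heG
  induction e with
  | h x y =>
    rw [SimpleGraph.mem_edgeFinset, SimpleGraph.mem_edgeSet, insideGraph_adj] at he
    rw [SimpleGraph.mem_edgeSet] at heG ⊢
    have key : ∀ u z, G.Adj (f u) z → c (f u) = c z → G'.Adj (f u) z := by
      intro u z h1 h2
      have : z ∈ nbrIn G c (f u) (c (f u)) := mem_nbrIn.2 ⟨h1, h2.symm⟩
      rw [hGG] at this
      exact (mem_nbrIn.1 this).1
    rcases hG x y heG he.2 with ⟨u, rfl⟩ | ⟨u, rfl⟩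
    · exact key u y heG he.2
    · exact (key u x heG.symm he.2.symm).symm

theorem two_rpow_mul_seven_eighths_le {r h n z : ℕ} (hr : 0 < r) (hh : 48 * r ≤ h)
    (hz : n ≤ 4 * r * z) :
    (2 : ℝ) ^ ((n : ℝ) / h) * (7 / 8) ^ z ≤ 2 ^ (-(n / (48 * r) : ℝ)) := by
  have hr' : (0 : ℝ) < r := by exact_mod_cast hr
  have h1 : (7 / 8 : ℝ) ^ z ≤ 2 ^ (-(n / (24 * r) : ℝ)) := by
    have h2 : ((7 / 8 : ℝ) ^ z) ^ 6 ≤ (2 ^ (-(n / (24 * r) : ℝ))) ^ 6 := by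
      rw [← pow_mul, mul_comm, pow_mul, ← Real.rpow_natCast (2 ^ (-(n / (24 * r) : ℝ))),
        ← Real.rpow_mul (by norm_num)]
      calc ((7 / 8 : ℝ) ^ 6) ^ z ≤ (1 / 2) ^ z := by gcongr; norm_num
        _ = 2 ^ (-(z : ℝ)) := by rw [Real.rpow_neg (by norm_num), Real.rpow_natCast]; simp
        _ ≤ _ := by
          refine Real.rpow_le_rpow_of_exponent_le (by norm_num) ?_
          have : (n : ℝ) ≤ 4 * r * z := by exact_mod_cast hz
          have h3 : (n : ℝ) / (24 * r) * 6 ≤ z := by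
            rw [div_mul_eq_mul_div, div_le_iff₀ (by positivity)]; linarith
          push_cast
          linarith
    exact le_of_pow_le_pow_left₀ (by norm_num) (by positivity) h2
  have h4 : (2 : ℝ) ^ ((n : ℝ) / h) ≤ 2 ^ (n / (48 * r) : ℝ) := by
    refine Real.rpow_le_rpow_of_exponent_le (by norm_num) ?_
    gcongr
    exact_mod_cast hh
  refine (mul_le_mul h4 h1 (by positivity) (by positivity)).trans ?_
  rw [← Real.rpow_add (by norm_num)]
  refine Real.rpow_le_rpow_of_exponent_le (by norm_num) (le_of_eq ?_)
  field_simp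
  ring

/-- Bound for the graphs in which every colour class is large, there is no hole, and the minimal
colouring `c` has few monochromatic edges. -/
theorem gdens_matching_cover_le {V : Type*} [Fintype V] {r k : ℕ} (hr : 0 < r) (c : V → Fin r)
    (hbig : ∀ i, Fintype.card V < 2 * r * #(colourClass c i))
    (h H m : ℕ) (hh : 48 * r ≤ h)
    (hrow : (#(univ.filter fun P : Finset V => h * #P ≤ Fintype.card V) : ℝ) ≤
      2 ^ (1 / (192 * r) * (Fintype.card V : ℝ)))
    (hH : (#(univ.filter fun P : Finset (V × V) => H * #P ≤ Fintype.card V ^ 2) : ℝ) ≤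
      2 ^ (1 / (1536 * r ^ 2) * (Fintype.card V ^ 2 : ℕ) : ℝ))
    (hm1 : 8 * r * m ≤ Fintype.card V) (hm2 : Fintype.card V ≤ 16 * r * m) (hk : k ≤ m)
    (f : Fin k ⊕ Fin k → V) (j : Fin k → Fin r) :
    gdens (fun G : SimpleGraph V => (H * #(monoPairs G c) ≤ Fintype.card V ^ 2 ∧
        IsInsideMatching G c f ∧ (∀ v, h * #(nbrIn G c v (c v)) ≤ Fintype.card V) ∧
        (k = m ∨ ∀ x y, G.Adj x y → c x = c y → (∃ a, f a = x) ∨ ∃ a, f a = y)) ∧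
        ∀ a, j a ≠ c (f (Sum.inl a)) ∧
          h * #(nbrIn G c (f (Sum.inl a)) (j a) ∩ nbrIn G c (f (Sum.inr a)) (j a)) <
            Fintype.card V) ≤
      (2 ^ (-((Fintype.card V : ℝ) / (96 * r)))) ^ k / 2 ^ #(insideGraph c).edgeFinset := by
  set n := Fintype.card V with hn
  set Q := fun G : SimpleGraph V => (H * #(monoPairs G c) ≤ n ^ 2 ∧
        IsInsideMatching G c f ∧ (∀ v, h * #(nbrIn G c v (c v)) ≤ n) ∧
        (k = m ∨ ∀ x y, G.Adj x y → c x = c y → (∃ a, f a = x) ∨ ∃ a, f a = y)) ∧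
        ∀ a, j a ≠ c (f (Sum.inl a)) ∧
          h * #(nbrIn G c (f (Sum.inl a)) (j a) ∩ nbrIn G c (f (Sum.inr a)) (j a)) < n with hQ
  have hr' : (0 : ℝ) < r := by exact_mod_cast hr
  by_cases hex : ∃ G, Q G
  swap
  · refine (gdens_mono (R := fun _ => False) fun G hG => hex ⟨G, hG⟩).trans ?_
    rw [gdens_false]
    positivity
  obtain ⟨G₀, hG₀⟩ := hex
  have hf := hG₀.1.2.1.1
  have hprod : ∏ a, ((2 : ℝ) ^ ((n : ℝ) / h) * (7 / 8) ^ #(colourClass c (j a) \ univ.image f)) ≤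
      (2 ^ (-(n / (48 * r) : ℝ))) ^ k := by
    refine (prod_le_prod (fun a _ => by positivity) fun a _ =>
      two_rpow_mul_seven_eighths_le (r := r) hr hh ?_).trans (le_of_eq (by simp))
    have h1 := le_card_sdiff (univ.image f) (colourClass c (j a))
    have h2 : #(univ.image f) ≤ 2 * k := by
      refine card_image_le.trans (le_of_eq ?_)
      simp [two_mul]
    have h3 := hbig (j a)
    have h4 : #(colourClass c (j a)) ≤ #(colourClass c (j a) \ univ.image f) + 2 * m := by omega
    have h5 := Nat.mul_le_mul_left (4 * r) h4
    nlinarith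
  suffices hS : ∃ S : ℝ, S ≤ (2 ^ ((n : ℝ) / (96 * r))) ^ k ∧
      gdens Q ≤ S / 2 ^ #(insideGraph c).edgeFinset *
        ∏ a, (2 ^ ((n : ℝ) / h) * (7 / 8) ^ #(colourClass c (j a) \ univ.image f)) by
    obtain ⟨S, hS1, hS2⟩ := hS
    refine hS2.trans ?_
    calc _ ≤ ((2 : ℝ) ^ ((n : ℝ) / (96 * r))) ^ k / 2 ^ #(insideGraph c).edgeFinset *
          ((2 : ℝ) ^ (-(n / (48 * r) : ℝ))) ^ k := by gcongr
      _ = ((2 : ℝ) ^ (-((n : ℝ) / (96 * r)))) ^ k / 2 ^ #(insideGraph c).edgeFinset := by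
        rw [div_mul_eq_mul_div, ← mul_pow, ← Real.rpow_add (by norm_num)]
        congr 4
        field_simp
        ring
  have hblock := fun (κ : Type _) => gdens_matching_le (κ := κ) c f hf (fun a => (hG₀.1.2.1.2 a).2) j
    (fun a => (hG₀.2 a).1) h n (by omega) Q (fun G hG a => (hG.2 a).2)
  by_cases hkm : k = m
  · refine ⟨_, ?_, hblock _ (fun G => monoPairs G c)
      (univ.filter fun P : Finset (V × V) => H * #P ≤ n ^ 2) (fun G hG => by simpa using hG.1.1)
      fun G G' _ _ hGG => edge_of_monoPairs_eq hGG⟩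
    refine hH.trans ?_
    rw [← Real.rpow_natCast ((2 : ℝ) ^ ((n : ℝ) / (96 * r))), ← Real.rpow_mul (by norm_num)]
    refine Real.rpow_le_rpow_of_exponent_le (by norm_num) ?_
    have h1 : (n : ℝ) ≤ 16 * r * k := by rw [hkm]; exact_mod_cast hm2
    push_cast
    calc 1 / (1536 * (r : ℝ) ^ 2) * (n : ℝ) ^ 2 = (n : ℝ) / (1536 * (r : ℝ) ^ 2) * n := by ring
      _ ≤ (n : ℝ) / (1536 * (r : ℝ) ^ 2) * (16 * r * k) := by gcongr
      _ = (n : ℝ) / (96 * r) * k := by field_simp; ring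
  · refine ⟨_, ?_, hblock _ (fun G u => nbrIn G c (f u) (c (f u)))
      (Fintype.piFinset fun _ : Fin k ⊕ Fin k => univ.filter fun P : Finset V => h * #P ≤ n)
      (fun G hG => by rw [Fintype.mem_piFinset]; intro u; simpa using hG.1.2.2.1 (f u))
      fun G G' hG _ hGG => edge_of_cover (hG.1.2.2.2.resolve_left hkm) fun u => congrFun hGG u⟩
    rw [Fintype.card_piFinset, prod_const, card_univ]
    push_cast
    rw [Fintype.card_sum, Fintype.card_fin, ← two_mul, pow_mul]
    refine pow_le_pow_left₀ (by positivity) ?_ k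
    refine (pow_le_pow_left₀ (by positivity) hrow 2).trans (le_of_eq ?_)
    rw [← Real.rpow_natCast _ 2, ← Real.rpow_mul (by norm_num)]
    have h1 : 1 / (192 * (r : ℝ)) * n * (2 : ℕ) = n / (96 * r) := by
      push_cast; field_simp; ring
    rw [h1]

theorem gdens_minColouring_le {V : Type*} [Fintype V] {r s : ℕ} (hr : 0 < r) (hs : 0 < s)
    (c : V → Fin r) (hbig : ∀ i, Fintype.card V < 2 * r * #(colourClass c i))
    (h H : ℕ) (hh : 48 * r ≤ h) (hn : 16 * r ≤ Fintype.card V)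
    (hrow : (#(univ.filter fun P : Finset V => h * #P ≤ Fintype.card V) : ℝ) ≤
      2 ^ (1 / (192 * r) * (Fintype.card V : ℝ)))
    (hH : (#(univ.filter fun P : Finset (V × V) => H * #P ≤ Fintype.card V ^ 2) : ℝ) ≤
      2 ^ (1 / (1536 * r ^ 2) * (Fintype.card V ^ 2 : ℕ) : ℝ))
    (hsmall : (Fintype.card V : ℝ) ^ 2 * r * 2 ^ (-((Fintype.card V : ℝ) / (96 * r))) ≤ 1) :
    gdens (fun G : SimpleGraph V => H * #(monoPairs G c) ≤ Fintype.card V ^ 2 ∧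
        IsMinColouring G c ∧ ¬ HasPlus r s G ∧ ¬ HasHole s h c G) ≤
      ((Fintype.card V : ℝ) + 1) / 2 ^ #(insideGraph c).edgeFinset := by
  set n := Fintype.card V with hnV
  set m := n / (8 * r) with hm
  have hm1 : 8 * r * m ≤ n := Nat.mul_div_le n (8 * r)
  have hm2 : n ≤ 16 * r * m := by
    have h1 : n < 8 * r * (m + 1) := Nat.lt_mul_div_succ n (by omega)
    have h2 : 1 ≤ m := by
      rw [hm, Nat.one_le_div_iff (by omega)]; omega
    nlinarith
  have hmn : m ≤ n := Nat.div_le_self _ _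
  set R : (k : ℕ) → (Fin k ⊕ Fin k → V) × (Fin k → Fin r) → SimpleGraph V → Prop := fun k p G =>
    (H * #(monoPairs G c) ≤ n ^ 2 ∧
        IsInsideMatching G c p.1 ∧ (∀ v, h * #(nbrIn G c v (c v)) ≤ n) ∧
        (k = m ∨ ∀ x y, G.Adj x y → c x = c y → (∃ a, p.1 a = x) ∨ ∃ a, p.1 a = y)) ∧
        ∀ a, p.2 a ≠ c (p.1 (Sum.inl a)) ∧
          h * #(nbrIn G c (p.1 (Sum.inl a)) (p.2 a) ∩ nbrIn G c (p.1 (Sum.inr a)) (p.2 a)) < n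
    with hR
  refine le_trans (gdens_mono (R := fun G => ∃ k ∈ range (m + 1), ∃ p, R k p G) ?_) ?_
  · rintro G ⟨hG1, hG2, hG3, hG4⟩
    obtain ⟨k, hk, f, hf, hcov⟩ := exists_insideMatching G c m
    choose j hj using fun a => exists_small_common_nbr (by omega) (by omega) hG3 hG4 hbig (hf.2 a).1
    exact ⟨k, by rw [mem_range]; omega, (f, j), ⟨hG1, hf,
      fun v => (hG2.mul_card_nbrIn_lt hs hG3 hG4 v).le, hcov⟩, hj⟩
  refine (gdens_exists_mem_le _ _ (c := 1 / 2 ^ #(insideGraph c).edgeFinset) fun k hk => ?_).trans ?_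
  · refine (gdens_exists_le (R k) fun p => gdens_matching_cover_le hr c hbig h H m hh hrow hH hm1 hm2
      (by rw [mem_range] at hk; omega) p.1 p.2).trans ?_
    rw [mul_div_assoc']
    refine div_le_div_of_nonneg_right ?_ (by positivity)
    rw [Fintype.card_prod, Fintype.card_fun, Fintype.card_fun, Fintype.card_sum, Fintype.card_fin,
      Fintype.card_fin, ← two_mul, pow_mul, ← mul_pow]
    push_cast
    rw [← mul_pow]
    exact pow_le_one₀ (by positivity) hsmall
  · rw [card_range, mul_one_div]
    gcongr
    exact_mod_cast Nat.succ_le_succ hmn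

theorem card_fun_fin_le (V : Type*) [Fintype V] (r : ℕ) :
    (Fintype.card (V → Fin r) : ℝ) ≤ 2 ^ (r * (Fintype.card V : ℝ)) := by
  rw [Fintype.card_fun, Fintype.card_fin, Real.rpow_mul (by norm_num), Real.rpow_natCast,
    Real.rpow_natCast]
  push_cast
  gcongr
  exact_mod_cast (Nat.lt_two_pow_self (n := r)).le

theorem gdens_close_le (r s : ℕ) (hr : 2 ≤ r) (hs : 0 < s) :
    ∃ D : ℕ, ∃ A : ℝ, 0 < A ∧ ∀ᶠ n in atTop, ∀ (V : Type) [Fintype V], Fintype.card V = n →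
      gdens (fun G : SimpleGraph V => ¬ HasPlus r s G ∧ IsClose r D G) ≤
        A * 2 ^ (-((n : ℝ) ^ 2 / (2 * r)) + (2 * r + 2) * n) := by
  have hr' : (0 : ℝ) < r := by exact_mod_cast (by omega : 0 < r)
  obtain ⟨h₀, hh₀⟩ := exists_card_small_subsets_le (1 / (192 * r)) (by positivity)
  set h := max h₀ (48 * r) with hh
  have hh48 : 48 * r ≤ h := le_max_right _ _
  have hhr : (48 : ℝ) * r ≤ h := by exact_mod_cast hh48
  have hh' : (0 : ℝ) < h := lt_of_lt_of_le (by positivity) hhr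
  have hhsq : 2304 * (r : ℝ) ^ 2 ≤ h ^ 2 := by nlinarith
  obtain ⟨H, hH⟩ := exists_card_small_subsets_le (1 / (4 * h ^ 2)) (by positivity)
  specialize hH H le_rfl
  obtain ⟨C, hC, hB2⟩ := gdens_hasHole_le r s h hr hs (by omega)
  refine ⟨4 * H, C + 2, by positivity, ?_⟩
  filter_upwards [eventually_ge_atTop (16 * r), eventually_pow_mul_const_pow_le 2 (r : ℝ)
    ((2 : ℝ) ^ (-(1 / (96 * r) : ℝ))) (by positivity)
    (Real.rpow_lt_one_of_one_lt_of_neg (by norm_num) (by simp; positivity)) (c := 1) (by norm_num)]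
    with n hn hsmall V _ hV
  subst hV
  set n := Fintype.card V with hnV
  set w : ℝ := 2 ^ (-((n : ℝ) ^ 2 / (2 * r)) + (r + 2) * n) with hw
  have hHn : (#(univ.filter fun P : Finset (V × V) => H * #P ≤ n ^ 2) : ℝ) ≤
      2 ^ (1 / (4 * (h : ℝ) ^ 2) * (n : ℝ) ^ 2) := by
    have := hH (V × V) (n ^ 2) (by rw [Fintype.card_prod, sq])
    push_cast at this
    exact this
  have hin : ∀ c : V → Fin r, (n : ℝ) ^ 2 / (2 * r) - n / 2 ≤ #(insideGraph c).edgeFinset :=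
    fun c => le_card_insideGraph (by omega) c
  have hinpow : ∀ c : V → Fin r, ∀ x : ℝ, x / 2 ^ #(insideGraph c).edgeFinset =
      x * 2 ^ (-(#(insideGraph c).edgeFinset : ℝ)) := by
    intro c x
    rw [Real.rpow_neg (by norm_num), Real.rpow_natCast, div_eq_mul_inv]
  have hn1 : (n : ℝ) + 1 ≤ 2 ^ (n : ℝ) := by
    rw [Real.rpow_natCast]
    exact_mod_cast Nat.lt_two_pow_self (n := n)
  have hn0 : (0 : ℝ) ≤ n := Nat.cast_nonneg _
  have hE1 : ∀ c : V → Fin r, gdens (fun G : SimpleGraph V => H * #(monoPairs G c) ≤ n ^ 2 ∧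
      ∃ i, 2 * r * #(colourClass c i) ≤ n) ≤ w := by
    intro c
    by_cases hi : ∃ i, 2 * r * #(colourClass c i) ≤ n
    swap
    · refine (gdens_mono (R := fun _ => False) fun G hG => hi hG.2).trans ?_
      rw [gdens_false]
      positivity
    obtain ⟨i, hi⟩ := hi
    have h1 : _ ≤ (#(insideGraph c).edgeFinset : ℝ) :=
      le_card_insideGraph_of_small (by omega) c i hi
    refine (gdens_mono fun G hG => hG.1).trans ((gdens_monoPairs_le c H (n ^ 2)).trans ?_)
    rw [hinpow]
    refine (mul_le_mul_of_nonneg_right hHn (by positivity)).trans ?_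
    rw [← Real.rpow_add (by norm_num)]
    refine Real.rpow_le_rpow_of_exponent_le (by norm_num) ?_
    have h2 : 1 / (4 * (h : ℝ) ^ 2) * (n : ℝ) ^ 2 ≤ (n : ℝ) ^ 2 / (8 * r ^ 2) := by
      rw [one_div_mul_eq_div]
      exact div_le_div_of_nonneg_left (by positivity) (by positivity) (by nlinarith)
    nlinarith
  have hE2 : ∀ c : V → Fin r, gdens (fun G : SimpleGraph V => H * #(monoPairs G c) ≤ n ^ 2 ∧
      HasHole s h c G) ≤ C * w := by
    intro c
    refine (hB2 V c H).trans ?_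
    rw [mul_assoc C, mul_left_comm]
    refine mul_le_mul_of_nonneg_left ?_ hC.le
    rw [hinpow, ← Real.rpow_natCast 2 (r * Fintype.card V)]
    refine (mul_le_mul_of_nonneg_left (mul_le_mul_of_nonneg_right
      (mul_le_mul_of_nonneg_right hHn (by positivity)) (by positivity)) (by positivity)).trans ?_
    rw [← Real.rpow_add (by norm_num), ← Real.rpow_add (by norm_num),
      ← Real.rpow_add (by norm_num)]
    refine Real.rpow_le_rpow_of_exponent_le (by norm_num) ?_
    have h1 := hin c
    have h2 : 1 / (4 * (h : ℝ) ^ 2) * (n : ℝ) ^ 2 = (n : ℝ) ^ 2 / (4 * h ^ 2) := by ring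
    rw [h2]
    push_cast
    nlinarith
  have hE3 : ∀ c : V → Fin r, gdens (fun G : SimpleGraph V => (∀ i, n < 2 * r * #(colourClass c i)) ∧
      H * #(monoPairs G c) ≤ n ^ 2 ∧ IsMinColouring G c ∧ ¬ HasPlus r s G ∧ ¬ HasHole s h c G) ≤
      w := by
    intro c
    by_cases hbig : ∀ i, n < 2 * r * #(colourClass c i)
    swap
    · refine (gdens_mono (R := fun _ => False) fun G hG => hbig hG.1).trans ?_
      rw [gdens_false]
      positivity
    refine (gdens_mono fun G hG => hG.2).trans ((gdens_minColouring_le (by omega) hs c hbig h H hh48 hn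
      (hh₀ h (le_max_left _ _) V n le_rfl) (hHn.trans ?_) ?_).trans ?_)
    · refine Real.rpow_le_rpow_of_exponent_le (by norm_num) ?_
      push_cast
      exact mul_le_mul_of_nonneg_right (one_div_le_one_div_of_le (by positivity) (by nlinarith))
        (sq_nonneg _)
    · refine le_trans ?_ hsmall
      rw [← Real.rpow_natCast ((2 : ℝ) ^ (-(1 / (96 * r) : ℝ))), ← Real.rpow_mul (by norm_num)]
      have h1 : -(1 / (96 * (r : ℝ))) * n = -((n : ℝ) / (96 * r)) := by ring
      rw [h1]
      gcongr
      linarith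
    · rw [hinpow]
      refine (mul_le_mul_of_nonneg_right hn1 (by positivity)).trans ?_
      rw [← Real.rpow_add (by norm_num)]
      refine Real.rpow_le_rpow_of_exponent_le (by norm_num) ?_
      have h1 := hin c
      nlinarith
  refine (gdens_mono (R := fun G => ∃ c : V → Fin r, (H * #(monoPairs G c) ≤ n ^ 2 ∧
      ∃ i, 2 * r * #(colourClass c i) ≤ n) ∨ (H * #(monoPairs G c) ≤ n ^ 2 ∧ HasHole s h c G) ∨
      ((∀ i, n < 2 * r * #(colourClass c i)) ∧
      H * #(monoPairs G c) ≤ n ^ 2 ∧ IsMinColouring G c ∧ ¬ HasPlus r s G ∧ ¬ HasHole s h c G))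
      ?_).trans ((gdens_exists_le _ (c := (C + 2) * w) fun c => ?_).trans ?_)
  · rintro G ⟨hP, c', hc'⟩
    have : Nonempty (V → Fin r) := ⟨c'⟩
    obtain ⟨c, hc⟩ := Finite.exists_min fun c : V → Fin r => #(monoPairs G c)
    have h1 : H * #(monoPairs G c) ≤ n ^ 2 := by
      rw [mul_assoc] at hc'
      exact (Nat.mul_le_mul_left H (hc c')).trans (Nat.le_of_mul_le_mul_left hc' (by norm_num))
    refine ⟨c, ?_⟩
    by_cases hb : ∀ i, n < 2 * r * #(colourClass c i)
    · by_cases hHo : HasHole s h c G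
      · exact Or.inr (Or.inl ⟨h1, hHo⟩)
      · exact Or.inr (Or.inr ⟨hb, h1, hc, hP, hHo⟩)
    · push Not at hb
      exact Or.inl ⟨h1, hb⟩
  · have h1 := (gdens_or_le _ _).trans (add_le_add (hE1 c)
      ((gdens_or_le _ _).trans (add_le_add (hE2 c) (hE3 c))))
    refine h1.trans (le_of_eq (by ring))
  · refine (mul_le_mul_of_nonneg_right (card_fun_fin_le V r) (by positivity)).trans (le_of_eq ?_)
    rw [mul_left_comm, hw, ← Real.rpow_add (by norm_num)]
    congr 2
    ring

/-- The proportion of graphs without a large complete `r`-partite graph plus an edge is at most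
`2^{-n²/(2r) + O(n)}`. -/
theorem gdens_not_hasPlus_le (r s : ℕ) (hr : 2 ≤ r) (hs : 0 < s) :
    ∃ C : ℝ, 0 < C ∧ ∀ n : ℕ, gdens (fun G : SimpleGraph (Fin n) => ¬ HasPlus r s G) ≤
      C * 2 ^ (-((n : ℝ) ^ 2 / (2 * r)) + (2 * r + 2) * n) := by
  obtain ⟨D, A, hA, hclose⟩ := gdens_close_le r s hr hs
  obtain ⟨t, hst, hfar⟩ := gdens_not_close_le r s D (by omega) hs
  obtain ⟨l, rfl⟩ : ∃ l, r = l + 1 := ⟨r - 1, by omega⟩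
  set r := l + 1 with hrl
  have hr' : (0 : ℝ) < r := by exact_mod_cast (by omega : 0 < r)
  obtain ⟨B, hB, hmult⟩ := gdens_not_hasMultipartite_le l t (1 / (2 * r)) (by positivity) (by
    rw [mul_one_div, div_lt_one (by positivity), hrl]; push_cast; linarith)
  have ht : 0 < t := hs.trans_le hst
  set k := r * t with hk
  have hk0 : 0 < k := Nat.mul_pos (by omega) ht
  have hkr : (k : ℝ) = r * t := by rw [hk]; push_cast; ring
  refine le_const_mul_of_recursion _ _ (fun n => gdens_le_one _) (fun n => by positivity) k hk0
    (B + A) ?_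
  filter_upwards [hclose, eventually_ge_atTop (2 * D * k), eventually_ge_atTop k,
    eventually_pow_mul_const_pow_le k ((r * 2 ^ k + 1) * 2 ^ (t * k) : ℝ) (1 / 2) (by norm_num)
      (by norm_num) (c := 1 / 2) (by norm_num)] with n hn1 hn2 hn3 hn4
  set w : ℕ → ℝ := fun n => 2 ^ (-((n : ℝ) ^ 2 / (2 * r)) + (2 * r + 2) * n) with hw
  have h1 : gdens (fun G : SimpleGraph (Fin n) => ¬ HasMultipartite r t G) ≤ B * w n := by
    refine (hmult (Fin n)).trans (mul_le_mul_of_nonneg_left ?_ hB.le)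
    refine Real.rpow_le_rpow_of_exponent_le (by norm_num) ?_
    rw [Fintype.card_fin, neg_mul, one_div_mul_eq_div]
    have : (0 : ℝ) ≤ (2 * r + 2) * n := by positivity
    linarith
  have h2 := hn1 (Fin n) (Fintype.card_fin n)
  have h3 := hfar (Fin n) (by rw [Fintype.card_fin]; exact hn2)
  rw [Fintype.card_fin] at h3
  have h4 : gdens (fun G : SimpleGraph (Fin n) => ¬ HasPlus r s G) ≤ _ :=
    (gdens_mono (R := fun G => (¬ HasMultipartite r t G) ∨ (¬ HasPlus r s G ∧ IsClose r D G) ∨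
      (¬ HasPlus r s G ∧ HasMultipartite r t G ∧ ¬ IsClose r D G)) fun G hG => by tauto).trans
    ((gdens_or_le _ _).trans (add_le_add h1 ((gdens_or_le _ _).trans (add_le_add h2 h3))))
  refine h4.trans ?_
  rw [← add_assoc, ← add_mul]
  refine add_le_add le_rfl ?_
  rw [← mul_assoc]
  refine mul_le_mul_of_nonneg_right ?_ (gdens_nonneg _)
  change _ ≤ w n / (2 * w (n - k))
  have hcast : ((n - k : ℕ) : ℝ) = n - k := Nat.cast_sub hn3
  have hwr : w n = w (n - k) * 2 ^ (-(t * n : ℝ) + (k * t / 2 + (2 * r + 2) * k)) := by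
    simp only [hw]
    rw [← Real.rpow_add (by norm_num), hcast, hkr]
    congr 1
    field_simp
    ring
  have hwpos : 0 < w (n - k) := by simp only [hw]; positivity
  have hrhs : w n / (2 * w (n - k)) = 2 ^ (-(t * n : ℝ) + (k * t / 2 + (2 * r + 2) * k)) / 2 := by
    rw [hwr]; field_simp
  have hhalf : ((1 : ℝ) / 2) ^ (t * (n - k)) = 2 ^ (-(t * n : ℝ)) * 2 ^ (t * k) := by
    rw [one_div, inv_pow, ← Real.rpow_natCast, ← Real.rpow_natCast, ← Real.rpow_neg (by norm_num),
      ← Real.rpow_add (by norm_num)]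
    push_cast
    rw [hcast]
    congr 1
    ring
  rw [hrhs, hhalf, Real.rpow_add (by norm_num)]
  have h5 : (1 : ℝ) ≤ 2 ^ (k * t / 2 + (2 * r + 2) * k : ℝ) :=
    Real.one_le_rpow (by norm_num) (by positivity)
  calc ((n : ℝ) + 1) ^ k * (r * 2 ^ k + 1) * (1 / 2) ^ n * (2 ^ (-(t * n : ℝ)) * 2 ^ (t * k))
      = ((n + 1) ^ k * ((r * 2 ^ k + 1) * 2 ^ (t * k)) * (1 / 2) ^ n) * 2 ^ (-(t * n : ℝ)) := by ring
    _ ≤ 1 / 2 * 2 ^ (-(t * n : ℝ)) := by gcongr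
    _ = 2 ^ (-(t * n : ℝ)) * 1 / 2 := by ring
    _ ≤ _ := by gcongr

theorem IsCritical.not_colorable {V : Type*} {r : ℕ} {F : SimpleGraph V} (hF : IsCritical r F) :
    ¬ F.Colorable r := by
  rw [← SimpleGraph.chromaticNumber_le_iff_colorable, hF.1, Nat.cast_le]
  omega

theorem HasPlus.hasCopy {V W : Type*} [Fintype V] {r : ℕ} {F : SimpleGraph V} {G : SimpleGraph W}
    (hF : IsCritical r F) (hG : HasPlus r (Fintype.card V) G) : HasCopy F G := by
  have hnc := hF.not_colorable
  obtain ⟨-, e, he, hχe⟩ := hF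
  induction e with
  | h x y =>
  obtain ⟨col⟩ := SimpleGraph.chromaticNumber_le_iff_colorable.1 hχe.le
  have hdel : ∀ u v, F.Adj u v → s(u, v) ≠ s(x, y) → col u ≠ col v := fun u v huv hne =>
    col.valid (by rw [SimpleGraph.deleteEdges_adj]; exact ⟨huv, by simpa using hne⟩)
  have hxy : col x = col y := by
    by_contra hne
    refine hnc ⟨SimpleGraph.Coloring.mk col fun {u v} huv => ?_⟩
    by_cases h : s(u, v) = s(x, y)
    · rcases Sym2.eq_iff.1 h with ⟨rfl, rfl⟩ | ⟨rfl, rfl⟩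
      · exact hne
      · exact fun h => hne h.symm
    · exact hdel u v huv h
  obtain ⟨T, hT, hTc, i, a, ha, b, hb, hab⟩ := hG
  have hdisj : ∀ j k, ∀ v ∈ T j, v ∈ T k → j = k := fun j k v hj hk => by
    by_contra hne
    exact (hTc j k hne v hj v hk).ne rfl
  have hemb : ∀ j, ∃ f : V ↪ W, (∀ v, f v ∈ T j) ∧ (j = i → f x = a ∧ f y = b) := by
    intro j
    obtain ⟨f⟩ : Nonempty (V ↪ T j) :=
      Function.Embedding.nonempty_of_card_le (by simpa using hT j)
    by_cases hj : j = i
    · subst hj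
      have hne : x ≠ y := he.ne
      set a' : T j := ⟨a, ha⟩ with ha'
      set b' : T j := ⟨b, hb⟩ with hb'
      have hab' : a' ≠ b' := fun h => hab.ne (congrArg Subtype.val h)
      set g := f.trans (Equiv.swap (f x) a').toEmbedding with hg
      have hgx : g x = a' := by simp [hg]
      have hgy : g y ≠ a' := fun h => hne (g.injective (hgx.trans h.symm))
      refine ⟨(g.trans (Equiv.swap (g y) b').toEmbedding).trans (Function.Embedding.subtype _),
        fun v => Subtype.coe_prop _, fun _ => ⟨?_, ?_⟩⟩
      · simp only [Function.Embedding.trans_apply, Equiv.coe_toEmbedding, hgx,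
          Function.Embedding.subtype_apply]
        rw [Equiv.swap_apply_of_ne_of_ne hgy.symm hab']
      · simp [hb']
    · exact ⟨f.trans (Function.Embedding.subtype _), fun v => (f v).2, fun h => absurd h hj⟩
  choose f hf hfi using hemb
  set c : V → Fin r := fun v => Equiv.swap (col x) i (col v) with hc
  have hcx : c x = i := by simp [hc]
  have hcy : c y = i := by simp [hc, ← hxy]
  refine ⟨⟨fun v => f (c v) v, fun u v huv => ?_⟩, fun u v huv => ?_⟩
  · have huv : f (c u) u = f (c v) v := huv
    have h1 := hdisj _ _ _ (hf (c u) u) (huv ▸ hf (c v) v)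
    rw [h1] at huv
    exact (f (c v)).injective huv
  · change G.Adj (f (c u) u) (f (c v) v)
    by_cases h : s(u, v) = s(x, y)
    · rcases Sym2.eq_iff.1 h with ⟨rfl, rfl⟩ | ⟨rfl, rfl⟩
      · rw [hcx, hcy, (hfi i rfl).1, (hfi i rfl).2]
        exact hab
      · rw [hcx, hcy, (hfi i rfl).1, (hfi i rfl).2]
        exact hab.symm
    · exact hTc _ _ (fun h' => hdel u v huv h ((Equiv.swap (col x) i).injective h')) _ (hf _ _) _
        (hf _ _)

theorem expXF_eq {V : Type*} (F : SimpleGraph V) (n m : ℕ) :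
    expXF F n m = n.choose m * gdens fun G : SimpleGraph (Fin m) => ¬ HasCopy F G := by
  unfold expXF gdens numFFree
  rw [Fintype.card_fin, mul_div_assoc]
  rfl

theorem pow_card_crossGraph_le_numFFree {V : Type*} {r m : ℕ} {F : SimpleGraph V}
    (hF : ¬ F.Colorable r) (c : Fin m → Fin r) :
    2 ^ #(crossGraph c).edgeFinset ≤ numFFree F m := by
  rw [← card_powerset, ← Nat.card_eq_finsetCard]
  have hfin : Finite {G : SimpleGraph (Fin m) // ¬ HasCopy F G} := inferInstance
  refine Nat.card_le_card_of_injective (fun S => ⟨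
    SimpleGraph.fromEdgeSet ((S : Finset (Sym2 (Fin m))) : Set (Sym2 (Fin m))), ?_⟩) ?_
  · rintro ⟨f, hf⟩
    refine hF ⟨SimpleGraph.Coloring.mk (fun v => c (f v)) fun {u v} huv => ?_⟩
    have h1 := (SimpleGraph.fromEdgeSet_adj _).1 (hf u v huv)
    have h2 := mem_powerset.1 S.2 (mem_coe.1 h1.1)
    rw [SimpleGraph.mem_edgeFinset, SimpleGraph.mem_edgeSet, crossGraph_adj] at h2
    exact h2
  · intro S S' hSS
    have h1 := congrArg SimpleGraph.edgeSet (Subtype.mk.inj hSS)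
    have h2 : ∀ S : (crossGraph c).edgeFinset.powerset,
        (SimpleGraph.fromEdgeSet ((S : Finset (Sym2 (Fin m))) : Set (Sym2 (Fin m)))).edgeSet =
          ((S : Finset (Sym2 (Fin m))) : Set (Sym2 (Fin m))) := by
      intro S
      rw [SimpleGraph.edgeSet_fromEdgeSet, sdiff_eq_left, Set.disjoint_left]
      intro e he hd
      exact not_isDiag_of_mem_edgeFinset (mem_powerset.1 S.2 he) hd
    rw [h2, h2, coe_inj] at h1
    exact Subtype.ext h1

theorem exists_card_insideGraph_le {r : ℕ} (hr : 0 < r) (m : ℕ) :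
    ∃ c : Fin m → Fin r, (#(insideGraph c).edgeFinset : ℝ) ≤ (m : ℝ) ^ 2 / (2 * r) := by
  set c : Fin m → Fin r := fun i => ⟨i % r, Nat.mod_lt _ hr⟩ with hc
  refine ⟨c, ?_⟩
  have hr' : (0 : ℝ) < r := by exact_mod_cast hr
  have h1 : ∀ i, r * #(colourClass c i) ≤ m + r := by
    intro i
    have h2 : #(colourClass c i) ≤ m / r + 1 := by
      have : #((colourClass c i).image fun v : Fin m => (v : ℕ) / r) ≤ #(range (m / r + 1)) := by
        refine card_le_card fun x hx => ?_
        obtain ⟨v, -, rfl⟩ := mem_image.1 hx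
        rw [mem_range]
        exact Nat.lt_succ_of_le (Nat.div_le_div_right v.2.le)
      rw [card_image_of_injOn, card_range] at this
      · exact this
      · intro v hv w hw hvw
        rw [mem_coe, mem_colourClass] at hv hw
        have h3 : (v : ℕ) % r = w % r := by
          have := hv.trans hw.symm
          simpa [hc] using this
        have h4 : (v : ℕ) / r = w / r := hvw
        ext
        rw [← Nat.div_add_mod (v : ℕ) r, h4, h3, Nat.div_add_mod]
    calc r * #(colourClass c i) ≤ r * (m / r + 1) := Nat.mul_le_mul_left _ h2
      _ ≤ m + r := by rw [mul_add, mul_one]; exact Nat.add_le_add_right (Nat.mul_div_le m r) r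
  have h5 := two_mul_card_insideGraph c
  have h6 : r * ∑ i, #(colourClass c i) ^ 2 ≤ (m + r) * m := by
    calc r * ∑ i, #(colourClass c i) ^ 2 = ∑ i, r * #(colourClass c i) * #(colourClass c i) := by
          rw [mul_sum]; exact sum_congr rfl fun i _ => by ring
      _ ≤ ∑ i, (m + r) * #(colourClass c i) := sum_le_sum fun i _ => Nat.mul_le_mul_right _ (h1 i)
      _ = _ := by rw [← mul_sum, sum_card_colour, Fintype.card_fin]
  rw [← h5, Fintype.card_fin] at h6
  rw [le_div_iff₀ (by positivity)]
  have h7 : (r : ℝ) * (2 * #(insideGraph c).edgeFinset + m) ≤ (m + r) * m := by exact_mod_cast h6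
  nlinarith

theorem one_lt_expXF {V : Type*} {r : ℕ} (hr : 0 < r) {F : SimpleGraph V} (hF : ¬ F.Colorable r)
    {n m : ℕ} (hm : 1 ≤ m) (hmn : 2 * m ≤ n)
    (h : (m : ℝ) / (2 * r) + Real.logb 2 (2 * m) < Real.logb 2 n) : 1 < expXF F n m := by
  obtain ⟨c, hc⟩ := exists_card_insideGraph_le hr m
  have hr' : (0 : ℝ) < r := by exact_mod_cast hr
  have hm' : (0 : ℝ) < m := by exact_mod_cast hm
  have hn' : (0 : ℝ) < n := by exact_mod_cast (by omega : 0 < n)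
  have h1 := card_crossGraph_add_card_insideGraph c
  rw [Fintype.card_fin] at h1
  have h2 : (n.choose m : ℝ) / 2 ^ #(insideGraph c).edgeFinset ≤ expXF F n m := by
    unfold expXF
    have h3 : (2 : ℝ) ^ #(crossGraph c).edgeFinset ≤ numFFree F m := by
      exact_mod_cast pow_card_crossGraph_le_numFFree hF c
    rw [← h1, pow_add, div_le_div_iff₀ (by positivity) (by positivity)]
    calc (n.choose m : ℝ) * (2 ^ #(crossGraph c).edgeFinset * 2 ^ #(insideGraph c).edgeFinset)
        = n.choose m * 2 ^ #(crossGraph c).edgeFinset * 2 ^ #(insideGraph c).edgeFinset := by ring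
      _ ≤ _ := by gcongr
  refine lt_of_lt_of_le ?_ h2
  rw [lt_div_iff₀ (by positivity), one_mul]
  have h4 : ((n : ℝ) / (2 * m)) ^ m ≤ n.choose m := by
    refine le_trans ?_ (Nat.pow_le_choose m n)
    have h5 : ((m.factorial : ℕ) : ℝ) ≤ m ^ m := by exact_mod_cast Nat.factorial_le_pow m
    have h6 : (n : ℝ) / 2 ≤ ((n + 1 - m : ℕ) : ℝ) := by
      rw [div_le_iff₀ (by norm_num)]
      exact_mod_cast (by omega : n ≤ (n + 1 - m) * 2)
    calc ((n : ℝ) / (2 * m)) ^ m = (n / 2) ^ m / m ^ m := by rw [← div_div, div_pow (n / 2 : ℝ)]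
      _ ≤ _ := by gcongr
  refine lt_of_lt_of_le ?_ h4
  have h7 : (2 : ℝ) ^ #(insideGraph c).edgeFinset ≤ (2 ^ ((m : ℝ) / (2 * r))) ^ m := by
    rw [← Real.rpow_natCast, ← Real.rpow_natCast, ← Real.rpow_mul (by norm_num)]
    refine Real.rpow_le_rpow_of_exponent_le (by norm_num) (hc.trans (le_of_eq (by ring)))
  refine lt_of_le_of_lt h7 (pow_lt_pow_left₀ ?_ (by positivity) (by omega))
  rw [← Real.lt_logb_iff_rpow_lt (by norm_num) (by positivity),
    Real.logb_div hn'.ne' (by positivity)]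
  linarith

theorem exists_expXF_le_one {V : Type*} [Fintype V] {r : ℕ} (hr : 2 ≤ r) {F : SimpleGraph V}
    (hF : IsCritical r F) : ∃ B : ℝ, 0 < B ∧ ∀ n m : ℕ, 1 ≤ n →
      2 * r * Real.logb 2 n + B ≤ m → expXF F n m ≤ 1 := by
  have hs : 0 < Fintype.card V := by
    rw [Fintype.card_pos_iff]
    by_contra h
    rw [not_nonempty_iff] at h
    exact hF.not_colorable ⟨SimpleGraph.Coloring.mk isEmptyElim fun {u} => isEmptyElim u⟩
  obtain ⟨C, hC, hCn⟩ := gdens_not_hasPlus_le r _ hr hs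
  have hr' : (0 : ℝ) < r := by exact_mod_cast (by omega : 0 < r)
  set L := max 0 (Real.logb 2 C) with hL
  have hL0 : 0 ≤ L := le_max_left _ _
  refine ⟨2 * r * (2 * r + 2 + L), by positivity, fun n m hn hm => ?_⟩
  have hn' : (0 : ℝ) < n := by exact_mod_cast hn
  have hlog : 0 ≤ Real.logb 2 n := Real.logb_nonneg (by norm_num) (by exact_mod_cast hn)
  have hm1 : (1 : ℝ) ≤ m := by
    refine le_trans ?_ hm
    have : (2 : ℝ) ≤ r := by exact_mod_cast hr
    nlinarith [mul_nonneg hr'.le hlog, mul_nonneg hr'.le hL0]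
  have h1 : (gdens fun G : SimpleGraph (Fin m) => ¬ HasCopy F G) ≤
      C * 2 ^ (-((m : ℝ) ^ 2 / (2 * r)) + (2 * r + 2) * m) :=
    (gdens_mono fun G (h : ¬ HasCopy F G) => mt (HasPlus.hasCopy hF) h).trans (hCn m)
  have h2 : (n.choose m : ℝ) ≤ 2 ^ (Real.logb 2 n * m) := by
    rw [Real.rpow_mul (by norm_num), Real.rpow_logb (by norm_num) (by norm_num) hn',
      Real.rpow_natCast]
    exact_mod_cast Nat.choose_le_pow n m
  have h3 : C ≤ 2 ^ (L * m) := by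
    calc C = 2 ^ Real.logb 2 C := (Real.rpow_logb (by norm_num) (by norm_num) hC).symm
      _ ≤ _ := Real.rpow_le_rpow_of_exponent_le (by norm_num)
        ((le_max_right _ _).trans (le_mul_of_one_le_right hL0 hm1))
  rw [expXF_eq]
  calc (n.choose m : ℝ) * gdens (fun G : SimpleGraph (Fin m) => ¬ HasCopy F G)
      ≤ 2 ^ (Real.logb 2 n * m) *
        (2 ^ (L * m) * 2 ^ (-((m : ℝ) ^ 2 / (2 * r)) + (2 * r + 2) * m)) := by
        have h4 := h1.trans (mul_le_mul_of_nonneg_right h3 (by positivity))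
        exact mul_le_mul h2 h4 (gdens_nonneg _) (by positivity)
    _ = 2 ^ (m * (Real.logb 2 n + (2 * r + 2 + L) - m / (2 * r)) : ℝ) := by
        rw [← Real.rpow_add (by norm_num), ← Real.rpow_add (by norm_num)]
        congr 1
        ring
    _ ≤ 1 := by
        have h4 : Real.logb 2 n + (2 * r + 2 + L) - m / (2 * r) ≤ 0 := by
          rw [sub_nonpos, le_div_iff₀ (by positivity)]
          linarith
        exact Real.rpow_le_one_of_one_le_of_nonpos (by norm_num)
          (mul_nonpos_of_nonneg_of_nonpos m.cast_nonneg h4)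

end

theorem stmt19 (r : ℕ) (hr : 2 ≤ r) (V : Type) [Fintype V] (F : SimpleGraph V)
    (hF : IsCritical r F) :
    ∃ C : ℝ, 0 < C ∧ ∃ N : ℕ, ∀ n : ℕ, N ≤ n →
      |(mZero F n : ℝ) - 2 * r * Real.logb 2 n| ≤ C * Real.log (Real.log n) := by
  obtain ⟨B, hB, hBn⟩ := exists_expXF_le_one hr hF
  have hr' : (0 : ℝ) < r := by exact_mod_cast (by omega : 0 < r)
  have hlogn : Filter.Tendsto (fun n : ℕ => Real.log n) Filter.atTop Filter.atTop :=
    Real.tendsto_log_atTop.comp tendsto_natCast_atTop_atTop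
  have hloglog : Filter.Tendsto (fun n : ℕ => Real.log (Real.log n)) Filter.atTop Filter.atTop :=
    Real.tendsto_log_atTop.comp hlogn
  have hsmall : ∀ᶠ n : ℕ in Filter.atTop, 8 * r * Real.log n ≤ n := by
    have h := tendsto_natCast_atTop_atTop.eventually
      (Real.isLittleO_log_id_atTop.bound (c := 1 / (8 * r)) (by positivity))
    filter_upwards [h] with n hn
    have h1 := (le_abs_self _).trans hn
    rw [id_eq, Real.norm_of_nonneg (Nat.cast_nonneg n), div_mul_eq_mul_div, one_mul,
      le_div_iff₀ (by positivity)] at h1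
    linarith
  obtain ⟨N, hN⟩ := Filter.eventually_atTop.1 ((hloglog.eventually_ge_atTop 1).and
    ((hloglog.eventually_ge_atTop (Real.log (8 * r))).and
      (hsmall.and ((hlogn.eventually_ge_atTop 1).and (Filter.eventually_ge_atTop 1)))))
  refine ⟨8 * r + B + 1, by positivity, N, fun n hn => ?_⟩
  obtain ⟨hL1, hL8, hsn, hl1, hn1⟩ := hN n hn
  have hn' : (0 : ℝ) < n := by exact_mod_cast hn1
  set L := Real.log (Real.log n) with hL
  set l := Real.logb 2 n with hl
  have hl0 : 0 ≤ l := Real.logb_nonneg (by norm_num) (by exact_mod_cast hn1)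
  have hlog2 : (1 : ℝ) / 2 ≤ Real.log 2 := by linarith [Real.log_two_gt_d9]
  have hlogb : ∀ x, 0 ≤ Real.log x → Real.logb 2 x ≤ 2 * Real.log x := fun x hx => by
    unfold Real.logb
    rw [div_le_iff₀ (by linarith)]
    nlinarith
  have hl2 : l ≤ 2 * Real.log n := hlogb _ (by linarith)
  have hmem : ⌈2 * r * l + B⌉₊ ∈ {m : ℕ | 1 ≤ m ∧ expXF F n m ≤ 1} :=
    ⟨Nat.one_le_ceil_iff.2 (by positivity), hBn n _ hn1 (Nat.le_ceil _)⟩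
  have hup : (mZero F n : ℝ) ≤ 2 * r * l + B + 1 :=
    le_trans (by exact_mod_cast Nat.sInf_le hmem) (Nat.ceil_lt_add_one (by positivity)).le
  obtain ⟨hm1, hmX⟩ := Nat.sInf_mem ⟨_, hmem⟩
  change 1 ≤ mZero F n at hm1
  change expXF F n (mZero F n) ≤ 1 at hmX
  have hlow : 2 * r * l - 8 * r * L ≤ mZero F n := by
    by_contra! hlt
    have hm' : (1 : ℝ) ≤ mZero F n := by exact_mod_cast hm1
    have hml : (mZero F n : ℝ) ≤ 4 * r * Real.log n := by nlinarith
    refine absurd hmX (not_le.2 (one_lt_expXF (by omega) hF.not_colorable hm1 ?_ ?_))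
    · have : 2 * (mZero F n : ℝ) ≤ n := by linarith
      exact_mod_cast this
    · have h1 : Real.log (2 * mZero F n) ≤ 2 * L := by
        calc Real.log (2 * mZero F n) ≤ Real.log (8 * r * Real.log n) :=
              Real.log_le_log (by positivity) (by linarith)
          _ = Real.log (8 * r) + L := Real.log_mul (by positivity) (by linarith)
          _ ≤ _ := by linarith
      have h2 := hlogb (2 * mZero F n) (Real.log_nonneg (by linarith))
      have h3 : (mZero F n : ℝ) / (2 * r) < l - 4 * L := by
        rw [div_lt_iff₀ (by positivity)]
        linarith
      linarith
  rw [abs_le]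
  constructor <;> nlinarith [mul_nonneg hr'.le (by linarith : 0 ≤ L)]
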